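/- Let h be a gauge function satisfying in addition the Dini-type regularity condition (R3): there is a constant C ≥ 1 with ∫_0^ℓ h(x)/x dx ≤ C h(ℓ) for all sufficiently small ℓ > 0. Let w be a non-negative function in L^1(|dz|) on 𝕋, let t, ε ∈ (0,∞), and suppose {p_N}_N is a sequence of polynomials such that (i') ∫_𝕋 |p_N|^t w |dz| → 0, and (ii') |p_N(z)| ≤ exp( ε · h(1-|z|)/(1-|z|) ) for all z ∈ 𝔻, uniformly in N. If there exists an h-Carleson set E ⊂ 𝕋 of positive arclength measure with ∫_E log w |dz| > -∞, then p_N(z) → 0 uniformly on compact subsets of 𝔻. -/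

import Mathlib

open MeasureTheory Set Filter Topology

noncomputable section

local instance : Fact (0 < 2 * Real.pi) := ⟨by positivity⟩

/-- The unit circle `𝕋`, modelled as `ℝ / 2πℤ` with its arclength (Haar) measure,
of total mass `2π`. -/
abbrev UnitCircle := AddCircle (2 * Real.pi)

/-- A gauge function: continuous, increasing on `[0,∞)`, vanishing at `0`, with
`(R1)` `h x / x` decreasing and `(R2)` `h x / x → ∞` as `x → 0+`. -/
structure IsGauge (h : ℝ → ℝ) : Prop where
  continuousOn : ContinuousOn h (Set.Ici 0)
  mono : MonotoneOn h (Set.Ici 0)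
  zero : h 0 = 0
  r1 : ∀ ⦃x y : ℝ⦄, 0 < x → x ≤ y → h y / y ≤ h x / x
  r2 : Filter.Tendsto (fun x => h x / x) (nhdsWithin 0 (Set.Ioi 0)) Filter.atTop

/-- An arc of the circle: a connected subset (the empty set is allowed as a
degenerate arc). -/
def IsArc (I : Set UnitCircle) : Prop := IsPreconnected I

/-- An `h`-Carleson set: a closed subset of the circle whose complement is a countable
disjoint union of open arcs `I_k` (namely its maximal complementary arcs) with
`Σ_k h(|I_k|) < ∞`. -/
def IsHCarleson (h : ℝ → ℝ) (E : Set UnitCircle) : Prop :=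
  IsClosed E ∧ ∃ I : ℕ → Set UnitCircle,
    (∀ k, IsOpen (I k) ∧ IsPreconnected (I k)) ∧
    (∀ k l, k ≠ l → Disjoint (I k) (I l)) ∧
    (⋃ k, I k) = Eᶜ ∧
    (∑' k, ENNReal.ofReal (h (volume (I k)).toReal)) < ⊤

/-- `nlog t = log⁺(1/t)`, valued in `[0,∞]`, with `nlog 0 = ∞`. For `w ≥ 0` this is
the function `R = log⁺(1/w)` of Khrushchev; moreover, since the positive part of
`log w` is automatically integrable for `w ∈ L¹`, the divergence condition
`∫_E log w |dζ| = -∞` is faithfully expressed as `∫⁻_E nlog (w ζ) |dζ| = ∞`. -/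
def nlog (t : ℝ) : ENNReal := if t = 0 then ⊤ else ENNReal.ofReal (Real.log t⁻¹)

/-- The embedding of `𝕋 = ℝ/2πℤ` into `ℂ`, `θ ↦ e^{iθ}`. -/
def circleEmbed (ζ : UnitCircle) : ℂ := (AddCircle.toCircle ζ : ℂ)

namespace SplittingSharpness

/-- The data of a function on the open upper half-plane `{(x, y) : 0 < y}` with its partial
derivatives up to the pure second order ones. -/
structure HasJet (f fx fy fxx fyy : ℝ × ℝ → ℝ) : Prop where
  dx : ∀ x y, 0 < y → HasDerivAt (fun s => f (s, y)) (fx (x, y)) x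
  dy : ∀ x y, 0 < y → HasDerivAt (fun s => f (x, s)) (fy (x, y)) y
  dxx : ∀ x y, 0 < y → HasDerivAt (fun s => fx (s, y)) (fxx (x, y)) x
  dyy : ∀ x y, 0 < y → HasDerivAt (fun s => fy (x, s)) (fyy (x, y)) y
  cont : ContinuousOn f {z | 0 < z.2}
  cont_xx : ContinuousOn fxx {z | 0 < z.2}
  cont_yy : ContinuousOn fyy {z | 0 < z.2}

/-- The divergence theorem on a rectangle for a field which is periodic in the first variable. -/
theorem integral_divergence_of_periodic {P Q Py Qx : ℝ × ℝ → ℝ} {L a b : ℝ} (hL : 0 ≤ L)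
    (hab : a ≤ b)
    (hP : ∀ x, ∀ y ∈ Icc a b, HasDerivAt (fun s => P (x, s)) (Py (x, y)) y)
    (hQ : ∀ x, ∀ y ∈ Icc a b, HasDerivAt (fun s => Q (s, y)) (Qx (x, y)) x)
    (hPc : ContinuousOn Py (Icc 0 L ×ˢ Icc a b)) (hQc : ContinuousOn Qx (Icc 0 L ×ˢ Icc a b))
    (hper : ∀ y ∈ Icc a b, Q (L, y) = Q (0, y)) :
    ∫ z in Icc 0 L ×ˢ Icc a b, (Qx z + Py z) = ∫ x in Icc 0 L, (P (x, b) - P (x, a)) := by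
  have hK : IsCompact (Icc 0 L ×ˢ Icc a b) := isCompact_Icc.prod isCompact_Icc
  have hPi : IntegrableOn Py (Icc 0 L ×ˢ Icc a b) := hPc.integrableOn_compact hK
  have hQi : IntegrableOn Qx (Icc 0 L ×ˢ Icc a b) := hQc.integrableOn_compact hK
  rw [integral_add hQi hPi]
  have h1 : ∫ z in Icc 0 L ×ˢ Icc a b, Qx z = 0 := by
    rw [Measure.volume_eq_prod, ← setIntegral_prod_swap, setIntegral_prod]
    · apply setIntegral_eq_zero_of_forall_eq_zero
      intro y hy
      simp only [Prod.swap_prod_mk]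
      rw [integral_Icc_eq_integral_Ioc, ← intervalIntegral.integral_of_le hL,
        intervalIntegral.integral_eq_sub_of_hasDerivAt (fun x _ => hQ x y hy), hper y hy, sub_self]
      apply ContinuousOn.intervalIntegrable
      rw [uIcc_of_le hL]
      exact hQc.comp (by fun_prop) (fun x hx => ⟨hx, hy⟩)
    · exact (hQi.swap : _)
  have h2 : ∫ z in Icc 0 L ×ˢ Icc a b, Py z = ∫ x in Icc 0 L, (P (x, b) - P (x, a)) := by
    rw [Measure.volume_eq_prod, setIntegral_prod _ hPi]
    apply setIntegral_congr_fun measurableSet_Icc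
    intro x hx
    simp only
    rw [integral_Icc_eq_integral_Ioc, ← intervalIntegral.integral_of_le hab,
        intervalIntegral.integral_eq_sub_of_hasDerivAt
          (fun y hy => hP x y (by rwa [uIcc_of_le hab] at hy))]
    apply ContinuousOn.intervalIntegrable
    rw [uIcc_of_le hab]
    exact hPc.comp (by fun_prop) (fun y hy => ⟨hx, hy⟩)
  rw [h1, h2, zero_add]

/-- Green's second identity on a rectangle for functions periodic in the first variable. -/
theorem HasJet.green {u ux uy uxx uyy f fx fy fxx fyy : ℝ × ℝ → ℝ} {L a b : ℝ}
    (hu : HasJet u ux uy uxx uyy) (hf : HasJet f fx fy fxx fyy) (hL : 0 ≤ L) (ha : 0 < a)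
    (hab : a ≤ b) (pu : ∀ y, 0 < y → u (L, y) = u (0, y))
    (pux : ∀ y, 0 < y → ux (L, y) = ux (0, y)) (pf : ∀ y, 0 < y → f (L, y) = f (0, y))
    (pfx : ∀ y, 0 < y → fx (L, y) = fx (0, y)) :
    ∫ z in Icc 0 L ×ˢ Icc a b, (f z * (uxx z + uyy z) - u z * (fxx z + fyy z)) =
      ∫ x in Icc 0 L, ((f (x, b) * uy (x, b) - u (x, b) * fy (x, b)) -
        (f (x, a) * uy (x, a) - u (x, a) * fy (x, a))) := by
  have hsub : Icc 0 L ×ˢ Icc a b ⊆ {z : ℝ × ℝ | 0 < z.2} := fun z hz => ha.trans_le hz.2.1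
  have key := integral_divergence_of_periodic (P := fun z => f z * uy z - u z * fy z)
    (Q := fun z => f z * ux z - u z * fx z)
    (Py := fun z => f z * uyy z - u z * fyy z) (Qx := fun z => f z * uxx z - u z * fxx z)
    hL hab ?_ ?_ ?_ ?_ ?_
  · rw [← key]
    congr 1
    ext z
    ring
  · intro x y hy
    have hy0 := ha.trans_le hy.1
    exact (((hf.dy x y hy0).mul (hu.dyy x y hy0)).sub
      ((hu.dy x y hy0).mul (hf.dyy x y hy0))).congr_deriv (by ring)
  · intro x y hy
    have hy0 := ha.trans_le hy.1
    exact (((hf.dx x y hy0).mul (hu.dxx x y hy0)).sub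
      ((hu.dx x y hy0).mul (hf.dxx x y hy0))).congr_deriv (by ring)
  · exact ((hf.cont.mul hu.cont_yy).sub (hu.cont.mul hf.cont_yy)).mono hsub
  · exact ((hf.cont.mul hu.cont_xx).sub (hu.cont.mul hf.cont_xx)).mono hsub
  · intro y hy
    have hy0 := ha.trans_le hy.1
    simp only [pu y hy0, pux y hy0, pf y hy0, pfx y hy0]

/-- Multiplication of a jet by a function of the second variable. -/
theorem HasJet.mul_snd {f fx fy fxx fyy : ℝ × ℝ → ℝ} (hf : HasJet f fx fy fxx fyy)
    (hfy : ContinuousOn fy {z | 0 < z.2})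
    {c c' c'' : ℝ → ℝ} (hc : ∀ y, HasDerivAt c (c' y) y) (hc' : ∀ y, HasDerivAt c' (c'' y) y)
    (hc'' : Continuous c'') :
    HasJet (fun z => c z.2 * f z) (fun z => c z.2 * fx z) (fun z => c' z.2 * f z + c z.2 * fy z)
      (fun z => c z.2 * fxx z)
      (fun z => c z.2 * fyy z + (c'' z.2 * f z + 2 * (c' z.2 * fy z))) := by
  have c1 : Continuous c := continuous_iff_continuousAt.2 fun y => (hc y).continuousAt
  have c2 : Continuous c' := continuous_iff_continuousAt.2 fun y => (hc' y).continuousAt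
  refine ⟨fun x y hy => (hf.dx x y hy).const_mul (c y), fun x y hy => (hc y).mul (hf.dy x y hy),
    fun x y hy => (hf.dxx x y hy).const_mul (c y), fun x y hy => ?_, ?_, ?_, ?_⟩
  · exact (((hc' y).mul (hf.dy x y hy)).add ((hc y).mul (hf.dyy x y hy))).congr_deriv (by ring)
  · exact (c1.comp continuous_snd).continuousOn.mul hf.cont
  · exact (c1.comp continuous_snd).continuousOn.mul hf.cont_xx
  · exact ((c1.comp continuous_snd).continuousOn.mul hf.cont_yy).add
      (((hc''.comp continuous_snd).continuousOn.mul hf.cont).add (continuousOn_const.mul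
        ((c2.comp continuous_snd).continuousOn.mul hfy)))

/-- The point `x + i y`. -/
def pt (z : ℝ × ℝ) : ℂ := ⟨z.1, z.2⟩

theorem continuous_pt : Continuous pt := by
  have : pt = fun z : ℝ × ℝ => (z.1 : ℂ) + z.2 * Complex.I := by
    ext z
    simp [pt, Complex.mk_eq_add_mul_I]
  rw [this]
  fun_prop

theorem hasDerivAt_pt_fst (x y : ℝ) : HasDerivAt (fun s : ℝ => pt (s, y)) 1 x := by
  have : (fun s : ℝ => pt (s, y)) = fun s : ℝ => (s : ℂ) + y * Complex.I := by
    ext z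
    simp [pt, Complex.mk_eq_add_mul_I]
  rw [this]
  exact (Complex.ofRealCLM.hasDerivAt (x := x)).add_const _

theorem hasDerivAt_pt_snd (x y : ℝ) : HasDerivAt (fun s : ℝ => pt (x, s)) Complex.I y := by
  have : (fun s : ℝ => pt (x, s)) = fun s : ℝ => (x : ℂ) + s * Complex.I := by
    ext z
    simp [pt, Complex.mk_eq_add_mul_I]
  rw [this]
  simpa using ((Complex.ofRealCLM.hasDerivAt (x := y)).mul_const Complex.I).const_add (x : ℂ)

section Partial

variable {f : ℂ → ℂ} {f' : ℂ} {x y : ℝ}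

theorem hasDerivAt_re_fst (h : HasDerivAt f f' (pt (x, y))) :
    HasDerivAt (fun s : ℝ => (f (pt (s, y))).re) f'.re x := by
  exact (Complex.reCLM.hasFDerivAt.comp_hasDerivAt x
    (h.comp x (hasDerivAt_pt_fst x y))).congr_deriv (by simp)

theorem hasDerivAt_im_fst (h : HasDerivAt f f' (pt (x, y))) :
    HasDerivAt (fun s : ℝ => (f (pt (s, y))).im) f'.im x := by
  exact (Complex.imCLM.hasFDerivAt.comp_hasDerivAt x
    (h.comp x (hasDerivAt_pt_fst x y))).congr_deriv (by simp)

theorem hasDerivAt_re_snd (h : HasDerivAt f f' (pt (x, y))) :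
    HasDerivAt (fun s : ℝ => (f (pt (x, s))).re) (-f'.im) y := by
  exact (Complex.reCLM.hasFDerivAt.comp_hasDerivAt y
    (h.comp y (hasDerivAt_pt_snd x y))).congr_deriv (by simp)

theorem hasDerivAt_im_snd (h : HasDerivAt f f' (pt (x, y))) :
    HasDerivAt (fun s : ℝ => (f (pt (x, s))).im) f'.re y := by
  exact (Complex.imCLM.hasFDerivAt.comp_hasDerivAt y
    (h.comp y (hasDerivAt_pt_snd x y))).congr_deriv (by simp)

end Partial

/-- `½ log (|f|² + η)`, a smooth regularisation of `log |f|`. -/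
def regLog (f : ℂ → ℂ) (η : ℝ) (z : ℂ) : ℝ := Real.log ((f z).re ^ 2 + (f z).im ^ 2 + η) / 2

/-- The regularised logarithm of an entire function is smooth and subharmonic. -/
theorem exists_hasJet_regLog {f : ℂ → ℂ} (hf : Differentiable ℂ f) {η : ℝ} (hη : 0 < η) {L : ℝ}
    (hL : Function.Periodic f (L : ℂ)) :
    ∃ ux uy uxx uyy : ℝ × ℝ → ℝ, HasJet (fun z => regLog f η (pt z)) ux uy uxx uyy ∧
      (∀ y, ux (L, y) = ux (0, y)) ∧ Continuous uy ∧ ∀ z, 0 ≤ uxx z + uyy z := by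
  have hf' : Differentiable ℂ (deriv f) := fun z => 
    ((hf.contDiff (n := 2)).differentiable_deriv_two).differentiableAt
  have hf'' : Differentiable ℂ (deriv (deriv f)) := fun z => 
    ((hf'.contDiff (n := 2)).differentiable_deriv_two).differentiableAt
  have d0 := fun z => (hf z).hasDerivAt
  have d1 := fun z => (hf' z).hasDerivAt
  set A : ℝ × ℝ → ℝ := fun z => (f (pt z)).re with hA
  set B : ℝ × ℝ → ℝ := fun z => (f (pt z)).im with hB
  set a : ℝ × ℝ → ℝ := fun z => (deriv f (pt z)).re with ha
  set b : ℝ × ℝ → ℝ := fun z => (deriv f (pt z)).im with hb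
  set a' : ℝ × ℝ → ℝ := fun z => (deriv (deriv f) (pt z)).re with ha'
  set b' : ℝ × ℝ → ℝ := fun z => (deriv (deriv f) (pt z)).im with hb'
  set D : ℝ × ℝ → ℝ := fun z => A z ^ 2 + B z ^ 2 + η with hD
  have cA : Continuous A := Complex.continuous_re.comp (hf.continuous.comp continuous_pt)
  have cB : Continuous B := Complex.continuous_im.comp (hf.continuous.comp continuous_pt)
  have ca : Continuous a := Complex.continuous_re.comp (hf'.continuous.comp continuous_pt)
  have cb : Continuous b := Complex.continuous_im.comp (hf'.continuous.comp continuous_pt)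
  have ca' : Continuous a' := Complex.continuous_re.comp (hf''.continuous.comp continuous_pt)
  have cb' : Continuous b' := Complex.continuous_im.comp (hf''.continuous.comp continuous_pt)
  have cD : Continuous D := by fun_prop
  have D0 : ∀ z, 0 < D z := fun z => by positivity
  have D1 : ∀ z, D z ≠ 0 := fun z => (D0 z).ne'
  have D2 : ∀ z, D z ^ 2 ≠ 0 := fun z => pow_ne_zero 2 (D1 z)
  have Dx : ∀ x y, HasDerivAt (fun s => D (s, y))
      (2 * (A (x, y) * a (x, y) + B (x, y) * b (x, y))) x := fun x y => by
    have h1 := ((hasDerivAt_re_fst (d0 (pt (x, y)))).pow 2).add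
      ((hasDerivAt_im_fst (d0 (pt (x, y)))).pow 2) |>.add_const η
    exact h1.congr_deriv (by simp [hA, hB, ha, hb]; ring)
  have Dy : ∀ x y, HasDerivAt (fun s => D (x, s))
      (2 * (B (x, y) * a (x, y) - A (x, y) * b (x, y))) y := fun x y => by
    have h1 := ((hasDerivAt_re_snd (d0 (pt (x, y)))).pow 2).add
      ((hasDerivAt_im_snd (d0 (pt (x, y)))).pow 2) |>.add_const η
    exact h1.congr_deriv (by simp [hA, hB, ha, hb]; ring)
  refine ⟨fun z => (A z * a z + B z * b z) / D z, fun z => (B z * a z - A z * b z) / D z,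
    fun z => (a z ^ 2 + b z ^ 2 + A z * a' z + B z * b' z) / D z -
      2 * (A z * a z + B z * b z) ^ 2 / D z ^ 2,
    fun z => (a z ^ 2 + b z ^ 2 - A z * a' z - B z * b' z) / D z -
      2 * (B z * a z - A z * b z) ^ 2 / D z ^ 2, ⟨?_, ?_, ?_, ?_, ?_, ?_, ?_⟩, ?_, ?_, ?_⟩
  · intro x y _
    exact (((Dx x y).log (D1 (x, y))).div_const 2).congr_deriv (by field_simp)
  · intro x y _
    exact (((Dy x y).log (D1 (x, y))).div_const 2).congr_deriv (by field_simp)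
  · intro x y _
    have h1 := (((hasDerivAt_re_fst (d0 (pt (x, y)))).mul (hasDerivAt_re_fst (d1 (pt (x, y))))).add
      ((hasDerivAt_im_fst (d0 (pt (x, y)))).mul (hasDerivAt_im_fst (d1 (pt (x, y)))))).div
      (Dx x y) (D1 (x, y))
    refine h1.congr_deriv ?_
    have := D1 (x, y)
    simp only [Pi.add_apply, Pi.mul_apply, hA, hB, ha, hb, ha', hb'] at this ⊢
    field_simp
    ring
  · intro x y _
    have h1 := (((hasDerivAt_im_snd (d0 (pt (x, y)))).mul (hasDerivAt_re_snd (d1 (pt (x, y))))).sub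
      ((hasDerivAt_re_snd (d0 (pt (x, y)))).mul (hasDerivAt_im_snd (d1 (pt (x, y)))))).div
      (Dy x y) (D1 (x, y))
    refine h1.congr_deriv ?_
    have := D1 (x, y)
    simp only [Pi.sub_apply, Pi.mul_apply, hA, hB, ha, hb, ha', hb'] at this ⊢
    field_simp
    ring
  · exact ((cD.log D1).div_const 2).continuousOn
  · apply Continuous.continuousOn
    fun_prop (disch := assumption)
  · apply Continuous.continuousOn
    fun_prop (disch := assumption)
  · intro y
    have e : pt (L, y) = pt (0, y) + L := by apply Complex.ext <;> simp [pt]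
    have e1 : f (pt (L, y)) = f (pt (0, y)) := by rw [e, hL]
    have e2 : deriv f (pt (L, y)) = deriv f (pt (0, y)) := by
      rw [e, ← deriv_comp_add_const]
      congr 1
      ext z
      exact hL z
    simp only [hD, hA, hB, ha, hb, e1, e2]
  · fun_prop (disch := assumption)
  · intro z
    have : (a z ^ 2 + b z ^ 2 + A z * a' z + B z * b' z) / D z -
      2 * (A z * a z + B z * b z) ^ 2 / D z ^ 2 +
      ((a z ^ 2 + b z ^ 2 - A z * a' z - B z * b' z) / D z -
      2 * (B z * a z - A z * b z) ^ 2 / D z ^ 2) =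
      2 * η * (a z ^ 2 + b z ^ 2) / D z ^ 2 := by
      have := D1 z
      field_simp
      simp only [hD]
      ring
    rw [this]
    positivity

theorem continuous_regLog {f : ℂ → ℂ} (hf : Continuous f) {η : ℝ} (hη : 0 < η) :
    Continuous (regLog f η) := by
  have h1 : Continuous fun z => (f z).re ^ 2 + (f z).im ^ 2 + η :=
    (((Complex.continuous_re.comp hf).pow 2).add ((Complex.continuous_im.comp hf).pow 2)).add
      continuous_const
  exact (h1.log fun z => by positivity).div_const 2

end SplittingSharpness

namespace SplittingSharpness

/-- The convex decreasing cut-off `m ↦ (1 - m)₊³`. -/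
def cut (m : ℝ) : ℝ := max 0 (1 - m) ^ 3

/-- The first derivative of `cut`. -/
def cut' (m : ℝ) : ℝ := -3 * max 0 (1 - m) ^ 2

/-- The second derivative of `cut`. -/
def cut'' (m : ℝ) : ℝ := 6 * max 0 (1 - m)

theorem hasDerivAt_max_zero_pow (n : ℕ) (x : ℝ) :
    HasDerivAt (fun s : ℝ => max 0 s ^ (n + 2)) ((n + 2) * max 0 x ^ (n + 1)) x := by
  rcases lt_trichotomy x 0 with hx | rfl | hx
  · have : (fun s : ℝ => max 0 s ^ (n + 2)) =ᶠ[𝓝 x] fun _ => 0 := by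
      filter_upwards [Iio_mem_nhds hx] with s hs
      simp [max_eq_left (mem_Iio.1 hs).le]
    simpa [max_eq_left hx.le] using (hasDerivAt_const x (0 : ℝ)).congr_of_eventuallyEq this
  · rw [hasDerivAt_iff_isLittleO]
    simp only [max_self, ne_eq, Nat.add_eq_zero_iff, OfNat.ofNat_ne_zero, and_false,
      not_false_eq_true, zero_pow, sub_zero, one_ne_zero, mul_zero, smul_zero]
    apply Asymptotics.IsBigO.trans_isLittleO (g := fun s : ℝ => s ^ (n + 2))
    · apply Asymptotics.IsBigO.of_bound 1
      filter_upwards with s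
      rw [one_mul, norm_pow, norm_pow]
      gcongr
      rw [Real.norm_eq_abs, Real.norm_eq_abs, abs_of_nonneg (le_max_left _ _)]
      exact max_le (abs_nonneg _) (le_abs_self _)
    · simpa using Asymptotics.isLittleO_pow_id (𝕜 := ℝ) (n := n + 2) (by omega)
  · have : (fun s : ℝ => max 0 s ^ (n + 2)) =ᶠ[𝓝 x] fun s => s ^ (n + 2) := by
      filter_upwards [Ioi_mem_nhds hx] with s hs
      simp only [max_eq_right (mem_Ioi.1 hs).le]
    have h2 := (hasDerivAt_pow (n + 2) x).congr_of_eventuallyEq this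
    simpa [max_eq_right hx.le] using h2

theorem hasDerivAt_cut (m : ℝ) : HasDerivAt cut (cut' m) m :=
  ((hasDerivAt_max_zero_pow 1 (1 - m)).comp m ((hasDerivAt_id m).const_sub 1)).congr_deriv
    (by simp only [cut']; push_cast; ring)

theorem hasDerivAt_cut' (m : ℝ) : HasDerivAt cut' (cut'' m) m :=
  (((hasDerivAt_max_zero_pow 0 (1 - m)).comp m ((hasDerivAt_id m).const_sub 1)).const_mul
    (-3)).congr_deriv (by simp only [cut'']; push_cast; ring)

theorem continuous_cut : Continuous cut := by unfold cut; fun_prop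
theorem continuous_cut' : Continuous cut' := by unfold cut'; fun_prop
theorem continuous_cut'' : Continuous cut'' := by unfold cut''; fun_prop

section Potential

variable (σ : ℝ → ℝ)

/-- The quotient of the Poisson integral of `σ` by the height. -/
def pot (z : ℂ) : ℝ := ∫ t : ℝ, σ t / ‖(t : ℂ) - z‖ ^ 2

/-- The cubic analogue of `pot`, controlling its gradient. -/
def potCube (z : ℂ) : ℝ := ∫ t : ℝ, σ t / ‖(t : ℂ) - z‖ ^ 3

/-- A holomorphic function whose imaginary part is the Poisson integral of `σ`. -/
def herglotz (z : ℂ) : ℂ :=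
  ∫ t : ℝ, (σ t : ℂ) * ((1 + t * z) / ((t - z) * (1 + (t : ℂ) ^ 2)))

/-- The derivative of `herglotz`. -/
def herglotz' (z : ℂ) : ℂ := ∫ t : ℝ, (σ t : ℂ) / ((t : ℂ) - z) ^ 2

variable {σ} {S : ℝ}

theorem im_le_norm_ofReal_sub (t : ℝ) (z : ℂ) : z.im ≤ ‖(t : ℂ) - z‖ := by
  have := Complex.abs_im_le_norm ((t : ℂ) - z)
  simp only [Complex.sub_im, Complex.ofReal_im, zero_sub, abs_neg] at this
  exact (le_abs_self _).trans this

theorem one_add_sq_le {A y₀ : ℝ} (hy₀ : 0 < y₀) {z : ℂ} (hz : ‖z‖ ≤ A) (hy : y₀ ≤ z.im) (t : ℝ) :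
    1 + t ^ 2 ≤ (2 + (2 * A ^ 2 + 1) / y₀ ^ 2) * ‖(t : ℂ) - z‖ ^ 2 := by
  have h1 : y₀ ≤ ‖(t : ℂ) - z‖ := hy.trans (im_le_norm_ofReal_sub t z)
  have h2 : |t| ≤ ‖(t : ℂ) - z‖ + A := by
    have := norm_add_le ((t : ℂ) - z) z
    simp only [sub_add_cancel, Complex.norm_real, Real.norm_eq_abs] at this
    linarith
  have hA : 0 ≤ A := (norm_nonneg z).trans hz
  have h3 : t ^ 2 ≤ 2 * ‖(t : ℂ) - z‖ ^ 2 + 2 * A ^ 2 := by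
    rw [← sq_abs]
    nlinarith [sq_nonneg (‖(t : ℂ) - z‖ - A), abs_nonneg t, norm_nonneg ((t : ℂ) - z)]
  have h4 : 2 * A ^ 2 + 1 ≤ (2 * A ^ 2 + 1) / y₀ ^ 2 * ‖(t : ℂ) - z‖ ^ 2 := by
    rw [div_mul_eq_mul_div, le_div_iff₀ (by positivity)]
    gcongr
  linarith

theorem inv_norm_sq_le {A y₀ : ℝ} (hy₀ : 0 < y₀) {z : ℂ} (hz : ‖z‖ ≤ A) (hy : y₀ ≤ z.im) (t : ℝ) :
    (‖(t : ℂ) - z‖ ^ 2)⁻¹ ≤ (2 + (2 * A ^ 2 + 1) / y₀ ^ 2) * (1 + t ^ 2)⁻¹ := by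
  have h1 : 0 < ‖(t : ℂ) - z‖ := hy₀.trans_le (hy.trans (im_le_norm_ofReal_sub t z))
  rw [← div_eq_mul_inv, inv_eq_one_div, div_le_div_iff₀ (by positivity) (by positivity), one_mul]
  exact one_add_sq_le hy₀ hz hy t

theorem ofReal_sub_ne_zero {z : ℂ} (hz : 0 < z.im) (t : ℝ) : (t : ℂ) - z ≠ 0 := by
  rw [← norm_pos_iff]
  exact hz.trans_le (im_le_norm_ofReal_sub t z)

theorem one_add_ofReal_sq_ne_zero (t : ℝ) : (1 + (t : ℂ) ^ 2) ≠ 0 := by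
  have : (1 + t ^ 2 : ℝ) ≠ 0 := by positivity
  exact_mod_cast this

theorem integrable_pot (hσ : Continuous σ) (h0 : ∀ t, 0 ≤ σ t) (hS : ∀ t, σ t ≤ S) {z : ℂ}
    (hz : 0 < z.im) : Integrable fun t : ℝ => σ t / ‖(t : ℂ) - z‖ ^ 2 := by
  have hn : ∀ t : ℝ, ‖(t : ℂ) - z‖ ^ 2 ≠ 0 := fun t =>
    pow_ne_zero 2 (norm_ne_zero_iff.2 (ofReal_sub_ne_zero hz t))
  refine (integrable_inv_one_add_sq.const_mul (S * (2 + (2 * ‖z‖ ^ 2 + 1) / z.im ^ 2))).mono'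
    (Continuous.aestronglyMeasurable (by fun_prop (disch := assumption))) (ae_of_all _ fun t => ?_)
  rw [Real.norm_of_nonneg (div_nonneg (h0 t) (by positivity)), div_eq_mul_inv, mul_assoc]
  exact mul_le_mul (hS t) (inv_norm_sq_le hz le_rfl le_rfl t) (by positivity)
    ((h0 t).trans (hS t))

theorem integrable_potCube (hσ : Continuous σ) (h0 : ∀ t, 0 ≤ σ t) (hS : ∀ t, σ t ≤ S) {z : ℂ}
    (hz : 0 < z.im) : Integrable fun t : ℝ => σ t / ‖(t : ℂ) - z‖ ^ 3 := by
  have hn : ∀ t : ℝ, ‖(t : ℂ) - z‖ ^ 3 ≠ 0 := fun t =>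
    pow_ne_zero 3 (norm_ne_zero_iff.2 (ofReal_sub_ne_zero hz t))
  refine ((integrable_pot hσ h0 hS hz).const_mul (z.im)⁻¹).mono'
    (Continuous.aestronglyMeasurable (by fun_prop (disch := assumption))) (ae_of_all _ fun t => ?_)
  have hp : 0 < ‖(t : ℂ) - z‖ := norm_pos_iff.2 (ofReal_sub_ne_zero hz t)
  rw [Real.norm_of_nonneg (div_nonneg (h0 t) (by positivity)), ← div_eq_inv_mul, div_div]
  refine div_le_div_of_nonneg_left (h0 t) (by positivity) ?_
  rw [pow_succ _ 2]
  exact mul_le_mul_of_nonneg_left (im_le_norm_ofReal_sub t z) (by positivity)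

theorem norm_herglotz'_integrand (h0 : ∀ t, 0 ≤ σ t) (z : ℂ) (t : ℝ) :
    ‖(σ t : ℂ) / ((t : ℂ) - z) ^ 2‖ = σ t / ‖(t : ℂ) - z‖ ^ 2 := by
  rw [norm_div, norm_pow, Complex.norm_real, Real.norm_of_nonneg (h0 t)]

theorem integrable_herglotz' (hσ : Continuous σ) (h0 : ∀ t, 0 ≤ σ t) (hS : ∀ t, σ t ≤ S) {z : ℂ}
    (hz : 0 < z.im) : Integrable fun t : ℝ => (σ t : ℂ) / ((t : ℂ) - z) ^ 2 := by
  have hn : ∀ t : ℝ, ((t : ℂ) - z) ^ 2 ≠ 0 := fun t => pow_ne_zero 2 (ofReal_sub_ne_zero hz t)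
  refine (integrable_pot hσ h0 hS hz).mono'
    (Continuous.aestronglyMeasurable (by fun_prop (disch := assumption))) (ae_of_all _ fun t => ?_)
  rw [norm_herglotz'_integrand h0]

theorem integrable_herglotz (hσ : Continuous σ) (h0 : ∀ t, 0 ≤ σ t) (hS : ∀ t, σ t ≤ S) {z : ℂ}
    (hz : 0 < z.im) :
    Integrable fun t : ℝ => (σ t : ℂ) * ((1 + t * z) / ((t - z) * (1 + (t : ℂ) ^ 2))) := by
  have hn : ∀ t : ℝ, ((t - z) * (1 + (t : ℂ) ^ 2)) ≠ 0 := fun t =>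
    mul_ne_zero (ofReal_sub_ne_zero hz t) (one_add_ofReal_sq_ne_zero t)
  refine (integrable_inv_one_add_sq.const_mul (S * (‖1 + z ^ 2‖ / z.im + ‖z‖))).mono'
    (Continuous.aestronglyMeasurable (by fun_prop (disch := assumption))) (ae_of_all _ fun t => ?_)
  have hp : 0 < ‖(t : ℂ) - z‖ := norm_pos_iff.2 (ofReal_sub_ne_zero hz t)
  have e : ‖1 + (t : ℂ) ^ 2‖ = 1 + t ^ 2 := by
    rw [← Real.norm_of_nonneg (by positivity : 0 ≤ 1 + t ^ 2), ← Complex.norm_real]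
    push_cast
    rfl
  rw [norm_mul, norm_div, norm_mul, Complex.norm_real, Real.norm_of_nonneg (h0 t), e, mul_assoc,
    ← div_div]
  refine mul_le_mul (hS t) ?_ (by positivity) ((h0 t).trans (hS t))
  rw [div_eq_mul_inv _ (1 + t ^ 2)]
  gcongr
  have : 1 + (t : ℂ) * z = (1 + z ^ 2) + z * (t - z) := by ring
  rw [this]
  calc ‖(1 + z ^ 2) + z * (t - z)‖ / ‖(t : ℂ) - z‖
      ≤ (‖1 + z ^ 2‖ + ‖z‖ * ‖(t : ℂ) - z‖) / ‖(t : ℂ) - z‖ := by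
        gcongr
        exact (norm_add_le _ _).trans_eq (by rw [norm_mul])
    _ = ‖1 + z ^ 2‖ / ‖(t : ℂ) - z‖ + ‖z‖ := by field_simp
    _ ≤ _ := by
        gcongr
        exact im_le_norm_ofReal_sub t z

theorem hasDerivAt_herglotz (hσ : Continuous σ) (h0 : ∀ t, 0 ≤ σ t) (hS : ∀ t, σ t ≤ S) {z : ℂ}
    (hz : 0 < z.im) : HasDerivAt (herglotz σ) (herglotz' σ z) z := by
  have hU : {w : ℂ | z.im / 2 < w.im} ∩ Metric.ball z 1 ∈ 𝓝 z :=
    inter_mem ((isOpen_lt continuous_const Complex.continuous_im).mem_nhds (by simp; linarith))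
      (Metric.ball_mem_nhds z one_pos)
  have him : ∀ w ∈ {w : ℂ | z.im / 2 < w.im} ∩ Metric.ball z 1, 0 < w.im := fun w hw =>
    (by linarith [hw.1.out] : (0 : ℝ) < w.im)
  refine (hasDerivAt_integral_of_dominated_loc_of_deriv_le (μ := volume)
    (F := fun z t => (σ t : ℂ) * ((1 + t * z) / ((t - z) * (1 + (t : ℂ) ^ 2))))
    (F' := fun z t => (σ t : ℂ) / ((t : ℂ) - z) ^ 2)
    (bound := fun t => S * (2 + (2 * (‖z‖ + 1) ^ 2 + 1) / (z.im / 2) ^ 2) * (1 + t ^ 2)⁻¹)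
    hU ?_ (integrable_herglotz hσ h0 hS hz) ?_ ?_ ?_ ?_).2
  · filter_upwards [hU] with w hw
    exact (integrable_herglotz hσ h0 hS (him w hw)).aestronglyMeasurable
  · exact (integrable_herglotz' hσ h0 hS hz).aestronglyMeasurable
  · refine ae_of_all _ fun t w hw => ?_
    rw [norm_herglotz'_integrand h0, div_eq_mul_inv, mul_assoc]
    refine mul_le_mul (hS t) (inv_norm_sq_le (by positivity) ?_ hw.1.out.le t) (by positivity)
      ((h0 t).trans (hS t))
    have := hw.2
    rw [Metric.mem_ball, dist_eq_norm] at this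
    have h2 := norm_add_le (w - z) z
    rw [sub_add_cancel] at h2
    linarith
  · exact integrable_inv_one_add_sq.const_mul _
  · refine ae_of_all _ fun t w hw => ?_
    have hn := ofReal_sub_ne_zero (him w hw) t
    have hn2 := one_add_ofReal_sq_ne_zero t
    have h1 : HasDerivAt (fun w : ℂ => 1 + (t : ℂ) * w) t w :=
      (((hasDerivAt_id w).const_mul (t : ℂ)).const_add 1).congr_deriv (by simp)
    have h2 : HasDerivAt (fun w : ℂ => ((t : ℂ) - w) * (1 + (t : ℂ) ^ 2)) (-(1 + (t : ℂ) ^ 2)) w :=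
      (((hasDerivAt_id w).const_sub (t : ℂ)).mul_const _).congr_deriv (by simp)
    refine ((h1.div h2 (mul_ne_zero hn hn2)).const_mul (σ t : ℂ)).congr_deriv ?_
    field_simp
    ring

theorem im_herglotz (hσ : Continuous σ) (h0 : ∀ t, 0 ≤ σ t) (hS : ∀ t, σ t ≤ S) {z : ℂ}
    (hz : 0 < z.im) : (herglotz σ z).im = z.im * pot σ z := by
  rw [herglotz, pot, ← integral_const_mul]
  refine (Complex.imCLM.integral_comp_comm (integrable_herglotz hσ h0 hS hz)).symm.trans ?_
  refine integral_congr_ae (ae_of_all _ fun t => ?_)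
  have hn := ofReal_sub_ne_zero hz t
  have hn2 := one_add_ofReal_sq_ne_zero t
  have e : (1 + t * z) / ((t - z) * (1 + (t : ℂ) ^ 2)) =
      ((t : ℂ) - z)⁻¹ - ((t / (1 + t ^ 2) : ℝ) : ℂ) := by
    push_cast
    field_simp
    ring
  simp only [Complex.imCLM_apply]
  rw [e, Complex.im_ofReal_mul, Complex.sub_im,
    Complex.ofReal_im, Complex.inv_im, Complex.normSq_eq_norm_sq]
  simp
  ring

theorem pot_nonneg (h0 : ∀ t, 0 ≤ σ t) (z : ℂ) : 0 ≤ pot σ z :=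
  integral_nonneg fun t => div_nonneg (h0 t) (by positivity)

theorem potCube_nonneg (h0 : ∀ t, 0 ≤ σ t) (z : ℂ) : 0 ≤ potCube σ z :=
  integral_nonneg fun t => div_nonneg (h0 t) (by positivity)

theorem norm_herglotz'_le (h0 : ∀ t, 0 ≤ σ t) (z : ℂ) : ‖herglotz' σ z‖ ≤ pot σ z :=
  (norm_integral_le_integral_norm _).trans_eq
    (integral_congr_ae (ae_of_all _ fun t => norm_herglotz'_integrand h0 z t))

theorem norm_herglotz'_sub_pot_le (hσ : Continuous σ) (h0 : ∀ t, 0 ≤ σ t) (hS : ∀ t, σ t ≤ S)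
    {z : ℂ} (hz : 0 < z.im) : ‖herglotz' σ z - pot σ z‖ ≤ 2 * z.im * potCube σ z := by
  have e : herglotz' σ z - pot σ z =
      ∫ t : ℝ, ((σ t : ℂ) / ((t : ℂ) - z) ^ 2 - ((σ t / ‖(t : ℂ) - z‖ ^ 2 : ℝ) : ℂ)) := by
    rw [herglotz', pot, ← integral_complex_ofReal]
    exact (integral_sub (integrable_herglotz' hσ h0 hS hz)
      (integrable_pot hσ h0 hS hz).ofReal).symm
  rw [e, potCube, ← integral_const_mul]
  refine (norm_integral_le_integral_norm _).trans (integral_mono_of_nonneg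
    (ae_of_all _ fun t => norm_nonneg _) ((integrable_potCube hσ h0 hS hz).const_mul _)
    (ae_of_all _ fun t => ?_))
  have hn := ofReal_sub_ne_zero hz t
  set w : ℂ := (t : ℂ) - z with hw
  have hp : 0 < ‖w‖ := norm_pos_iff.2 hn
  have hc : (starRingEnd ℂ) w ≠ 0 := by simpa using hn
  have e2 : ((σ t / ‖w‖ ^ 2 : ℝ) : ℂ) = (σ t : ℂ) / (w * (starRingEnd ℂ) w) := by
    rw [Complex.mul_conj, Complex.normSq_eq_norm_sq]
    push_cast
    rfl
  have e3 : (σ t : ℂ) / w ^ 2 - (σ t : ℂ) / (w * (starRingEnd ℂ) w) =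
      (σ t : ℂ) * ((starRingEnd ℂ) w - w) / (w ^ 2 * (starRingEnd ℂ) w) := by
    field_simp
  have e4 : ‖(starRingEnd ℂ) w - w‖ = 2 * z.im := by
    have : (starRingEnd ℂ) w - w = ((2 * z.im : ℝ) : ℂ) * Complex.I := by
      apply Complex.ext <;> simp [hw]
      ring
    rw [this, norm_mul, Complex.norm_I, Complex.norm_real, mul_one,
      Real.norm_of_nonneg (by positivity)]
  simp only
  rw [e2, e3, norm_div, norm_mul, norm_mul, norm_pow, Complex.norm_conj, Complex.norm_real,
    Real.norm_of_nonneg (h0 t), e4]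
  rw [← hw]
  apply le_of_eq
  field_simp

theorem norm_herglotz'_sub_pot_le' (h0 : ∀ t, 0 ≤ σ t) (z : ℂ) :
    ‖herglotz' σ z - pot σ z‖ ≤ 2 * pot σ z := by
  refine (norm_sub_le _ _).trans ?_
  rw [Complex.norm_real, Real.norm_of_nonneg (pot_nonneg h0 z)]
  linarith [norm_herglotz'_le h0 z]

theorem pot_add_period {T : ℝ} (hT : Function.Periodic σ T) (z : ℂ) :
    pot σ (z + T) = pot σ z := by
  rw [pot, pot, ← integral_add_right_eq_self _ T]
  congr 1
  ext t
  rw [hT t]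
  congr 3
  push_cast
  ring

theorem herglotz'_add_period {T : ℝ} (hT : Function.Periodic σ T) (z : ℂ) :
    herglotz' σ (z + T) = herglotz' σ z := by
  rw [herglotz', herglotz', ← integral_add_right_eq_self _ T]
  congr 1
  ext t
  rw [hT t]
  congr 2
  push_cast
  ring

end Potential

end SplittingSharpness

namespace SplittingSharpness

variable {σ : ℝ → ℝ} {S : ℝ}

theorem cut_mem_Icc {m : ℝ} (hm : 0 ≤ m) : cut m ∈ Icc (0 : ℝ) 1 := by
  have h1 : max 0 (1 - m) ≤ 1 := max_le zero_le_one (by linarith)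
  exact ⟨pow_nonneg (le_max_left _ _) _, pow_le_one₀ (le_max_left _ _) h1⟩

theorem abs_cut'_le {m : ℝ} (hm : 0 ≤ m) : |cut' m| ≤ 3 := by
  have h1 : max 0 (1 - m) ≤ 1 := max_le zero_le_one (by linarith)
  rw [cut', abs_mul, abs_of_nonneg (pow_nonneg (le_max_left 0 (1 - m)) 2)]
  norm_num
  rwa [abs_of_nonneg (le_max_left _ _)]

theorem cut_eq_zero {m : ℝ} (hm : 1 ≤ m) : cut m = 0 := by
  simp [cut, max_eq_left (by linarith : 1 - m ≤ 0)]

theorem cut'_eq_zero {m : ℝ} (hm : 1 ≤ m) : cut' m = 0 := by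
  simp [cut', max_eq_left (by linarith : 1 - m ≤ 0)]

theorem cut''_eq_zero {m : ℝ} (hm : 1 ≤ m) : cut'' m = 0 := by
  simp [cut'', max_eq_left (by linarith : 1 - m ≤ 0)]

theorem cut''_nonneg (m : ℝ) : 0 ≤ cut'' m := mul_nonneg (by norm_num) (le_max_left _ _)

/-- The subharmonic test function `y G(M)`, where `M` is the potential of `σ` and `G` the
cut-off. -/
def testFn (σ : ℝ → ℝ) (z : ℝ × ℝ) : ℝ := z.2 * cut (pot σ (pt z))

/-- The vertical derivative of `testFn`. -/
def testFnY (σ : ℝ → ℝ) (z : ℝ × ℝ) : ℝ :=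
  cut (pot σ (pt z)) + cut' (pot σ (pt z)) * ((herglotz' σ (pt z)).re - pot σ (pt z))

theorem abs_testFnY_le (h0 : ∀ t, 0 ≤ σ t) (z : ℝ × ℝ) : |testFnY σ z| ≤ 7 := by
  have hM := pot_nonneg h0 (pt z)
  rcases le_or_gt 1 (pot σ (pt z)) with h | h
  · simp [testFnY, cut_eq_zero h, cut'_eq_zero h]
  · have h1 : |(herglotz' σ (pt z)).re - pot σ (pt z)| ≤ 2 := by
      have := Complex.abs_re_le_norm (herglotz' σ (pt z) - pot σ (pt z))
      have h2 := norm_herglotz'_sub_pot_le' h0 (pt z)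
      simp only [Complex.sub_re, Complex.ofReal_re] at this
      linarith
    refine (abs_add_le _ _).trans ?_
    have h3 := cut_mem_Icc hM
    rw [abs_mul, abs_of_nonneg h3.1]
    have := mul_le_mul (abs_cut'_le hM) h1 (abs_nonneg _) (by norm_num)
    linarith [h3.2]

theorem testFn_mem_Icc (h0 : ∀ t, 0 ≤ σ t) {z : ℝ × ℝ} (hz : 0 < z.2) :
    testFn σ z ∈ Icc 0 z.2 := by
  have h3 := cut_mem_Icc (pot_nonneg h0 (pt z))
  exact ⟨mul_nonneg hz.le h3.1, mul_le_of_le_one_right hz.le h3.2⟩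

theorem differentiableAt_herglotz' (hσ : Continuous σ) (h0 : ∀ t, 0 ≤ σ t) (hS : ∀ t, σ t ≤ S)
    {z : ℂ} (hz : 0 < z.im) : DifferentiableAt ℂ (herglotz' σ) z := by
  have ho : IsOpen {w : ℂ | 0 < w.im} := isOpen_lt continuous_const Complex.continuous_im
  have h1 : DifferentiableOn ℂ (herglotz σ) {w : ℂ | 0 < w.im} := fun w hw =>
    (hasDerivAt_herglotz hσ h0 hS hw).differentiableAt.differentiableWithinAt
  refine ((h1.deriv ho).differentiableAt (ho.mem_nhds hz)).congr_of_eventuallyEq ?_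
  filter_upwards [ho.mem_nhds hz] with w hw
  exact (hasDerivAt_herglotz hσ h0 hS hw).deriv.symm

theorem continuousOn_comp_pt {X : Type*} [TopologicalSpace X] {f : ℂ → X}
    (hf : ∀ z : ℂ, 0 < z.im → ContinuousAt f z) :
    ContinuousOn (fun z => f (pt z)) {z : ℝ × ℝ | 0 < z.2} := fun z hz =>
  ((hf (pt z) hz).comp continuous_pt.continuousAt).continuousWithinAt

theorem continuousAt_pot (hσ : Continuous σ) (h0 : ∀ t, 0 ≤ σ t) (hS : ∀ t, σ t ≤ S) (z : ℂ)
    (hz : 0 < z.im) : ContinuousAt (pot σ) z := by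
  have ho : IsOpen {w : ℂ | 0 < w.im} := isOpen_lt continuous_const Complex.continuous_im
  have h1 : ContinuousAt (fun w => (herglotz σ w).im / w.im) z :=
    (Complex.continuous_im.continuousAt.comp
      (hasDerivAt_herglotz hσ h0 hS hz).continuousAt).div
      Complex.continuous_im.continuousAt hz.ne'
  refine h1.congr ?_
  filter_upwards [ho.mem_nhds hz] with w hw
  have hw' : 0 < w.im := hw
  rw [im_herglotz hσ h0 hS hw, mul_div_cancel_left₀ _ hw'.ne']

theorem hasDerivAt_pot_fst (hσ : Continuous σ) (h0 : ∀ t, 0 ≤ σ t) (hS : ∀ t, σ t ≤ S) (x : ℝ)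
    {y : ℝ} (hy : 0 < y) :
    HasDerivAt (fun s => pot σ (pt (s, y))) ((herglotz' σ (pt (x, y))).im / y) x := by
  refine ((hasDerivAt_im_fst (hasDerivAt_herglotz hσ h0 hS (z := pt (x, y)) hy)).div_const
    y).congr_of_eventuallyEq (Eventually.of_forall fun s => ?_)
  simp only
  rw [im_herglotz hσ h0 hS (z := pt (s, y)) hy]
  exact (mul_div_cancel_left₀ _ hy.ne').symm

theorem hasDerivAt_pot_snd (hσ : Continuous σ) (h0 : ∀ t, 0 ≤ σ t) (hS : ∀ t, σ t ≤ S) (x : ℝ)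
    {y : ℝ} (hy : 0 < y) :
    HasDerivAt (fun s => pot σ (pt (x, s)))
      (((herglotz' σ (pt (x, y))).re - pot σ (pt (x, y))) / y) y := by
  have h1 := (hasDerivAt_im_snd (hasDerivAt_herglotz hσ h0 hS (z := pt (x, y)) hy)).div
    (hasDerivAt_id y) hy.ne'
  refine (h1.congr_of_eventuallyEq ?_).congr_deriv ?_
  · filter_upwards [Ioi_mem_nhds hy] with s hs
    have hs' : 0 < s := hs
    simp only [Pi.div_apply, id]
    rw [im_herglotz hσ h0 hS (z := pt (x, s)) hs']
    exact (mul_div_cancel_left₀ _ hs'.ne').symm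
  · rw [im_herglotz hσ h0 hS (z := pt (x, y)) hy]
    simp only [pt, id]
    field_simp

theorem exists_hasJet_testFn (hσ : Continuous σ) (h0 : ∀ t, 0 ≤ σ t) (hS : ∀ t, σ t ≤ S) {L : ℝ}
    (hL : Function.Periodic σ L) :
    ∃ fx fxx fyy : ℝ × ℝ → ℝ, HasJet (testFn σ) fx (testFnY σ) fxx fyy ∧
      ContinuousOn (testFnY σ) {z | 0 < z.2} ∧
      (∀ y, testFn σ (L, y) = testFn σ (0, y)) ∧ (∀ y, fx (L, y) = fx (0, y)) ∧
      ∀ z, 0 < z.2 → 0 ≤ fxx z + fyy z ∧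
        fxx z + fyy z ≤ if pot σ (pt z) < 1 then 24 * potCube σ (pt z) else 0 := by
  have cM := continuousOn_comp_pt (continuousAt_pot hσ h0 hS)
  have cH : ContinuousOn (fun z => herglotz' σ (pt z)) {z : ℝ × ℝ | 0 < z.2} :=
    continuousOn_comp_pt fun z hz => (differentiableAt_herglotz' hσ h0 hS hz).continuousAt
  have cH' : ContinuousOn (fun z => deriv (herglotz' σ) (pt z)) {z : ℝ × ℝ | 0 < z.2} := by
    refine continuousOn_comp_pt fun z hz => ?_
    have ho : IsOpen {w : ℂ | 0 < w.im} := isOpen_lt continuous_const Complex.continuous_im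
    have h1 : DifferentiableOn ℂ (herglotz' σ) {w : ℂ | 0 < w.im} := fun w hw =>
      (differentiableAt_herglotz' hσ h0 hS hw).differentiableWithinAt
    exact ((h1.deriv ho).differentiableAt (ho.mem_nhds hz)).continuousAt
  have c2 : ContinuousOn (fun z : ℝ × ℝ => z.2) {z : ℝ × ℝ | 0 < z.2} := continuousOn_snd
  have cre := Complex.continuous_re.comp_continuousOn cH
  have cim := Complex.continuous_im.comp_continuousOn cH
  have cim' := Complex.continuous_im.comp_continuousOn cH'
  have cg := continuous_cut.comp_continuousOn cM
  have cg' := continuous_cut'.comp_continuousOn cM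
  have cg'' := continuous_cut''.comp_continuousOn cM
  have hper : ∀ y : ℝ, pt (L, y) = pt (0, y) + L := fun y => by
    apply Complex.ext <;> simp [pt]
  refine ⟨fun z => cut' (pot σ (pt z)) * (herglotz' σ (pt z)).im,
    fun z => cut'' (pot σ (pt z)) / z.2 * (herglotz' σ (pt z)).im ^ 2 +
      cut' (pot σ (pt z)) * (deriv (herglotz' σ) (pt z)).im,
    fun z => cut'' (pot σ (pt z)) / z.2 * ((herglotz' σ (pt z)).re - pot σ (pt z)) ^ 2 -
      cut' (pot σ (pt z)) * (deriv (herglotz' σ) (pt z)).im,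
    ⟨fun x y hy => ?_, fun x y hy => ?_, fun x y hy => ?_, fun x y hy => ?_, c2.mul cg,
      (((cg''.div c2 fun z hz => hz.ne').mul (cim.pow 2)).add (cg'.mul cim')),
      (((cg''.div c2 fun z hz => hz.ne').mul ((cre.sub cM).pow 2)).sub (cg'.mul cim'))⟩,
    cg.add (cg'.mul (cre.sub cM)), fun y => ?_, fun y => ?_, fun z hz => ?_⟩
  · have hM := hasDerivAt_pot_fst hσ h0 hS x hy
    refine (((hasDerivAt_cut _).comp x hM).const_mul y).congr_deriv ?_
    field_simp
  · have hM := hasDerivAt_pot_snd hσ h0 hS x hy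
    refine ((hasDerivAt_id y).mul ((hasDerivAt_cut _).comp y hM)).congr_deriv ?_
    simp only [testFnY, id, Function.comp]
    field_simp
  · have hM := hasDerivAt_pot_fst hσ h0 hS x hy
    have hH := hasDerivAt_im_fst
      (differentiableAt_herglotz' hσ h0 hS (z := pt (x, y)) hy).hasDerivAt
    refine (((hasDerivAt_cut' _).comp x hM).mul hH).congr_deriv ?_
    simp only [Function.comp]
    ring
  · have hM := hasDerivAt_pot_snd hσ h0 hS x hy
    have hH := hasDerivAt_re_snd
      (differentiableAt_herglotz' hσ h0 hS (z := pt (x, y)) hy).hasDerivAt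
    refine (((hasDerivAt_cut _).comp y hM).add
      (((hasDerivAt_cut' _).comp y hM).mul (hH.sub hM))).congr_deriv ?_
    simp only [Function.comp, Pi.sub_apply]
    ring
  · simp only [testFn, hper, pot_add_period hL]
  · simp only [hper, pot_add_period hL, herglotz'_add_period hL]
  · have e : cut'' (pot σ (pt z)) / z.2 * (herglotz' σ (pt z)).im ^ 2 +
        cut' (pot σ (pt z)) * (deriv (herglotz' σ) (pt z)).im +
        (cut'' (pot σ (pt z)) / z.2 * ((herglotz' σ (pt z)).re - pot σ (pt z)) ^ 2 -
        cut' (pot σ (pt z)) * (deriv (herglotz' σ) (pt z)).im) =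
        cut'' (pot σ (pt z)) / z.2 * ‖herglotz' σ (pt z) - pot σ (pt z)‖ ^ 2 := by
      rw [← Complex.normSq_eq_norm_sq, Complex.normSq_apply]
      simp only [Complex.sub_re, Complex.sub_im, Complex.ofReal_re, Complex.ofReal_im]
      ring
    simp only [e]
    refine ⟨mul_nonneg (div_nonneg (cut''_nonneg _) hz.le) (by positivity), ?_⟩
    split_ifs with h
    · have hM := pot_nonneg h0 (pt z)
      have hN := potCube_nonneg h0 (pt z)
      have h1 := norm_herglotz'_sub_pot_le hσ h0 hS (z := pt z) hz
      have h2 := norm_herglotz'_sub_pot_le' h0 (pt z)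
      have h3 : ‖herglotz' σ (pt z) - pot σ (pt z)‖ ^ 2 ≤
          (2 * z.2 * potCube σ (pt z)) * 2 := by
        rw [sq]
        exact mul_le_mul h1 (by linarith) (norm_nonneg _) (by positivity)
      have h4 : cut'' (pot σ (pt z)) ≤ 6 := by
        have : max 0 (1 - pot σ (pt z)) ≤ 1 := max_le zero_le_one (by linarith)
        rw [cut'']
        linarith
      calc _ ≤ 6 / z.2 * ((2 * z.2 * potCube σ (pt z)) * 2) := by gcongr
        _ = 24 * potCube σ (pt z) := by field_simp; ring
    · rw [cut''_eq_zero (not_lt.1 h)]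
      simp

end SplittingSharpness

namespace SplittingSharpness

section Gauge

variable {h : ℝ → ℝ}

theorem gauge_pos (hg : IsGauge h) {x : ℝ} (hx : 0 < x) : 0 < h x := by
  have h1 : ∀ᶠ y in 𝓝[>] (0 : ℝ), 0 < h y / y := hg.r2.eventually_gt_atTop 0
  obtain ⟨y, hy, hy0, hyx⟩ := (h1.and (Ioo_mem_nhdsGT hx)).exists
  have : 0 < h y := by
    have := mul_pos hy hy0
    rwa [div_mul_cancel₀ _ hy0.ne'] at this
  exact this.trans_le (hg.mono hy0.le hx.le hyx.le)

theorem gauge_nonneg (hg : IsGauge h) {x : ℝ} (hx : 0 ≤ x) : 0 ≤ h x := by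
  rcases hx.eq_or_lt with rfl | hx
  · exact hg.zero.ge
  · exact (gauge_pos hg hx).le

theorem gauge_mul_div_le (hg : IsGauge h) {c x : ℝ} (hc : 0 < c) (hc1 : c ≤ 1) (hx : 0 ≤ x) :
    h (c * x) / (c * x) ≤ c⁻¹ * (h x / x) := by
  rw [inv_mul_eq_div, div_div, mul_comm x c]
  exact div_le_div_of_nonneg_right
    (hg.mono (mul_nonneg hc.le hx) hx (mul_le_of_le_one_left hx hc1)) (by positivity)

theorem gauge_dini (hg : IsGauge h) {C ℓ₀ : ℝ} (hC : 1 ≤ C) (hℓ₀ : 0 < ℓ₀)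
    (hR3 : ∀ ℓ : ℝ, 0 < ℓ → ℓ ≤ ℓ₀ →
      IntervalIntegrable (fun x => h x / x) volume 0 ℓ ∧
      (∫ x in (0:ℝ)..ℓ, h x / x) ≤ C * h ℓ) (R : ℝ) :
    ∃ D : ℝ, 0 ≤ D ∧ ∀ ℓ, 0 < ℓ → ℓ ≤ R →
      ∫⁻ x in Ioc 0 ℓ, ENNReal.ofReal (h x / x) ≤ ENNReal.ofReal (D * h ℓ) := by
  have small : ∀ ℓ, 0 < ℓ → ℓ ≤ ℓ₀ →
      ∫⁻ x in Ioc 0 ℓ, ENNReal.ofReal (h x / x) ≤ ENNReal.ofReal (C * h ℓ) := by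
    intro ℓ hl hl0
    obtain ⟨h1, h2⟩ := hR3 ℓ hl hl0
    rw [intervalIntegral.integral_of_le hl.le] at h2
    rw [← ofReal_integral_eq_lintegral_ofReal ((intervalIntegrable_iff_integrableOn_Ioc_of_le
      hl.le).1 h1)]
    · exact ENNReal.ofReal_le_ofReal h2
    · filter_upwards [ae_restrict_mem measurableSet_Ioc] with x hx
      exact div_nonneg (gauge_nonneg hg hx.1.le) hx.1.le
  refine ⟨C + |R| / ℓ₀, by positivity, fun ℓ hl hlR => ?_⟩
  have hh := gauge_pos hg hl
  rcases le_or_gt ℓ ℓ₀ with h1 | h1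
  · refine (small ℓ hl h1).trans (ENNReal.ofReal_le_ofReal ?_)
    gcongr
    linarith [show (0 : ℝ) ≤ |R| / ℓ₀ by positivity]
  · rw [← Ioc_union_Ioc_eq_Ioc hℓ₀.le h1.le, add_mul,
      ENNReal.ofReal_add (by positivity) (by positivity)]
    refine (lintegral_union_le _ _ _).trans (add_le_add ((small ℓ₀ hℓ₀ le_rfl).trans
      (ENNReal.ofReal_le_ofReal ?_)) ?_)
    · gcongr
      exact hg.mono hℓ₀.le hl.le h1.le
    · calc ∫⁻ x in Ioc ℓ₀ ℓ, ENNReal.ofReal (h x / x)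
          ≤ ∫⁻ x in Ioc ℓ₀ ℓ, ENNReal.ofReal (h ℓ / ℓ₀) := by
            refine setLIntegral_mono measurable_const fun x hx => ENNReal.ofReal_le_ofReal ?_
            have hx0 : 0 < x := hℓ₀.trans hx.1
            exact div_le_div₀ hh.le (hg.mono hx0.le hl.le hx.2) hℓ₀ hx.1.le
        _ = ENNReal.ofReal (h ℓ / ℓ₀ * (ℓ - ℓ₀)) := by
            rw [lintegral_const, Measure.restrict_apply_univ, Real.volume_Ioc,
              ← ENNReal.ofReal_mul (by positivity)]
        _ ≤ _ := by
            refine ENNReal.ofReal_le_ofReal ?_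
            rw [div_mul_eq_mul_div, div_mul_eq_mul_div, mul_comm |R|]
            gcongr
            linarith [le_abs_self R]

end Gauge

theorem lintegral_periodic_Ioc {T : ℝ} (hT : 0 < T) {f : ℝ → ENNReal}
    (hf : Function.Periodic f T) (a b : ℝ) :
    ∫⁻ x in Ioc a (a + T), f x = ∫⁻ x in Ioc b (b + T), f x := by
  refine (isAddFundamentalDomain_Ioc hT a).setLIntegral_eq
    (isAddFundamentalDomain_Ioc hT b) f fun g x => ?_
  obtain ⟨g, hg⟩ := g
  obtain ⟨n, rfl⟩ := AddSubgroup.mem_zmultiples_iff.1 hg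
  have := hf.zsmul n x
  rw [add_comm] at this
  exact this

theorem lintegral_periodic_add {T : ℝ} (hT : 0 < T) {f : ℝ → ENNReal} (hf : Function.Periodic f T)
    (a s : ℝ) : ∫⁻ x in Ioc a (a + T), f (x + s) = ∫⁻ x in Ioc a (a + T), f x := by
  rw [lintegral_periodic_Ioc hT hf a (a + s)]
  have h2 := (measurePreserving_add_right volume s).setLIntegral_comp_preimage_emb
    (measurableEmbedding_addRight s) f (Ioc (a + s) (a + s + T))
  rw [← h2]
  congr 2
  ext x
  simp only [mem_Ioc, mem_preimage]
  constructor <;> rintro ⟨h3, h4⟩ <;> constructor <;> linarith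

/-- Change of variables `t = x + s` over one period. -/
theorem lintegral_unfold {T : ℝ} (hT : 0 < T) {K : ℝ → ℝ → ENNReal}
    (hK : Measurable (Function.uncurry K)) (hp : ∀ s, Function.Periodic (fun t => K t s) T)
    (a : ℝ) :
    ∫⁻ x in Ioc a (a + T), ∫⁻ t, K t (t - x) = ∫⁻ t in Ioc a (a + T), ∫⁻ s, K t s := by
  have h1 : ∀ x, ∫⁻ t, K t (t - x) = ∫⁻ s, K (x + s) s := fun x => by
    rw [← lintegral_add_left_eq_self _ x]
    simp
  simp_rw [h1]
  rw [lintegral_lintegral_swap (by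
      exact (hK.comp ((measurable_fst.add measurable_snd).prodMk measurable_snd)).aemeasurable),
    lintegral_lintegral_swap (f := fun t s => K t s) (by exact hK.aemeasurable)]
  exact lintegral_congr fun s => lintegral_periodic_add hT (hp s) a s

theorem lintegral_cauchy_kernel {b : ℝ} (hb : 0 < b) :
    ∫⁻ s : ℝ, ENNReal.ofReal (1 / (s ^ 2 + b ^ 2)) = ENNReal.ofReal (Real.pi / b) := by
  have e : (fun s : ℝ => 1 / (s ^ 2 + b ^ 2)) =
      fun s => (b ^ 2)⁻¹ * (fun x : ℝ => (1 + x ^ 2)⁻¹) (b⁻¹ * s) := by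
    ext s
    field_simp
    rw [add_comm]
  have hi : Integrable (fun s : ℝ => 1 / (s ^ 2 + b ^ 2)) := by
    rw [e]
    exact (integrable_inv_one_add_sq.comp_mul_left' (inv_ne_zero hb.ne')).const_mul _
  rw [← ofReal_integral_eq_lintegral_ofReal hi (ae_of_all _ fun s => by positivity), e,
    integral_const_mul, Measure.integral_comp_mul_left (fun x : ℝ => (1 + x ^ 2)⁻¹),
    integral_univ_inv_one_add_sq, inv_inv,
    abs_of_pos hb, smul_eq_mul]
  congr 1
  field_simp

theorem le_norm_sub_of_pot_lt_one {σ : ℝ → ℝ} {S : ℝ} (hσ : LipschitzWith 1 σ)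
    (h0 : ∀ t, 0 ≤ σ t) (hS : ∀ t, σ t ≤ S) {z : ℂ} (hz : 0 < z.im) (hM : pot σ z < 1) (t : ℝ) :
    σ t / 4 ≤ ‖(t : ℂ) - z‖ := by
  by_contra! hlt
  have hs : 0 < σ t := by linarith [norm_nonneg ((t : ℂ) - z)]
  have h1 : ∫ r : ℝ, (Icc (t - σ t / 4) (t + σ t / 4)).indicator (fun _ => 2 / σ t) r = 1 := by
    rw [integral_indicator measurableSet_Icc, setIntegral_const, Measure.real, Real.volume_Icc,
      ENNReal.toReal_ofReal (by linarith), smul_eq_mul]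
    field_simp
    ring
  refine absurd hM (not_lt.2 ?_)
  rw [← h1, pot]
  refine integral_mono_of_nonneg
    (ae_of_all _ fun r => indicator_nonneg (fun _ _ => by positivity) r)
    (integrable_pot hσ.continuous h0 hS hz) (ae_of_all _ fun r => ?_)
  simp only
  by_cases hr : r ∈ Icc (t - σ t / 4) (t + σ t / 4)
  · rw [indicator_of_mem hr]
    have hrt : |r - t| ≤ σ t / 4 := abs_le.2 ⟨by linarith [hr.1], by linarith [hr.2]⟩
    have h2 : σ t / 2 ≤ σ r := by
      have := hσ.dist_le_mul r t
      rw [Real.dist_eq, Real.dist_eq, NNReal.coe_one, one_mul] at this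
      linarith [(abs_le.1 this).1]
    have h3 : ‖(r : ℂ) - z‖ ≤ σ t / 2 := by
      have h4 : (r : ℂ) - z = ((r - t : ℝ) : ℂ) + (t - z) := by push_cast; ring
      rw [h4]
      refine (norm_add_le _ _).trans ?_
      rw [Complex.norm_real, Real.norm_eq_abs]
      linarith
    have h5 : 0 < ‖(r : ℂ) - z‖ := norm_pos_iff.2 (ofReal_sub_ne_zero hz r)
    calc 2 / σ t = (σ t / 2) / (σ t / 2) ^ 2 := by field_simp
      _ ≤ _ := by gcongr; exact h0 r
  · rw [indicator_of_notMem hr]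
    exact div_nonneg (h0 r) (by positivity)

end SplittingSharpness

namespace SplittingSharpness

/-- The preimage in `ℝ` of a subset of the circle. -/
def lift (E : Set UnitCircle) : Set ℝ := {t : ℝ | (t : UnitCircle) ∈ E}

/-- The distance to the lift of `E`. -/
def gap (E : Set UnitCircle) (t : ℝ) : ℝ := Metric.infDist t (lift E)

variable {E : Set UnitCircle} {h : ℝ → ℝ}

theorem isClosed_lift (hE : IsClosed E) : IsClosed (lift E) :=
  hE.preimage (AddCircle.continuous_mk' _)

theorem add_mem_lift_iff (t : ℝ) : t + 2 * Real.pi ∈ lift E ↔ t ∈ lift E := by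
  have : ((t + 2 * Real.pi : ℝ) : UnitCircle) = t := AddCircle.coe_add_period _ t
  change ((t + 2 * Real.pi : ℝ) : UnitCircle) ∈ E ↔ (t : UnitCircle) ∈ E
  rw [this]

theorem lift_nonempty (hE : E.Nonempty) : (lift E).Nonempty := by
  obtain ⟨x, hx⟩ := hE
  obtain ⟨t, rfl⟩ := QuotientAddGroup.mk_surjective x
  exact ⟨t, hx⟩

theorem gap_nonneg (t : ℝ) : 0 ≤ gap E t := Metric.infDist_nonneg

theorem lipschitzWith_gap : LipschitzWith 1 (gap E) := Metric.lipschitz_infDist_pt _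

theorem gap_pos (hE : IsClosed E) (hne : E.Nonempty) {t : ℝ} (ht : t ∉ lift E) : 0 < gap E t :=
  ((isClosed_lift hE).notMem_iff_infDist_pos (lift_nonempty hne)).1 ht

theorem gap_eq_zero {t : ℝ} (ht : t ∈ lift E) : gap E t = 0 := Metric.infDist_zero_of_mem ht

theorem periodic_gap : Function.Periodic (gap E) (2 * Real.pi) := fun t => by
  have himg : (fun s : ℝ => s + 2 * Real.pi) '' lift E = lift E := by
    ext s
    constructor
    · rintro ⟨r, hr, rfl⟩
      exact (add_mem_lift_iff r).2 hr
    · intro hs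
      exact ⟨s - 2 * Real.pi, (add_mem_lift_iff _).1 (by simpa using hs), by simp⟩
  have := Metric.infDist_image (x := t) (t := lift E) (isometry_add_right (2 * Real.pi))
  rw [himg] at this
  exact this

theorem gap_le (hne : E.Nonempty) (t : ℝ) : gap E t ≤ 2 * Real.pi := by
  obtain ⟨e, he⟩ := lift_nonempty hne
  have hT : 0 < 2 * Real.pi := by positivity
  have h1 := toIcoMod_mem_Ico hT t e
  have h2 : toIcoMod hT t e ∈ lift E := by
    have : ((toIcoMod hT t e : ℝ) : UnitCircle) = e := by
      rw [toIcoMod]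
      rw [AddCircle.coe_sub, AddCircle.coe_zsmul, AddCircle.coe_period, smul_zero, sub_zero]
    exact (this ▸ he : ((toIcoMod hT t e : ℝ) : UnitCircle) ∈ E)
  refine (Metric.infDist_le_dist_of_mem h2).trans ?_
  rw [Real.dist_eq, abs_sub_comm, abs_of_nonneg (by linarith [h1.1])]
  linarith [h1.2]

theorem lintegral_gauge_gap_Ioo_le (hg : IsGauge h) {D : ℝ}
    (hD : ∀ ℓ, 0 < ℓ → ℓ ≤ 2 * Real.pi →
      ∫⁻ x in Ioc 0 ℓ, ENNReal.ofReal (h x / x) ≤ ENNReal.ofReal (D * h ℓ))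
    (hhm : Continuous h) (hne : E.Nonempty) {a b : ℝ} (hab : a < b) (hb : b - a ≤ 2 * Real.pi)
    (hdisj : ∀ t ∈ Ioo a b, t ∉ lift E) :
    ∫⁻ t in Ioo a b, ENNReal.ofReal (h (gap E t) / gap E t) ≤
      2 * ENNReal.ofReal (D * h (b - a)) := by
  have hm : Measurable fun x => ENNReal.ofReal (h x / x) :=
    (hhm.measurable.div measurable_id).ennreal_ofReal
  have h1 : ∫⁻ t in Ioo a b, ENNReal.ofReal (h (t - a) / (t - a)) ≤
      ENNReal.ofReal (D * h (b - a)) := by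
    refine le_trans (le_of_eq ?_) (hD (b - a) (sub_pos.2 hab) hb)
    rw [Measure.restrict_congr_set Ioo_ae_eq_Ioc.symm]
    have h2 := (measurePreserving_sub_right volume a).setLIntegral_comp_preimage_emb
      (MeasurableEquiv.subRight a).measurableEmbedding
      (fun x => ENNReal.ofReal (h x / x)) (Ioo 0 (b - a))
    rw [← h2]
    congr 2
    ext x
    simp
  have h2 : ∫⁻ t in Ioo a b, ENNReal.ofReal (h (b - t) / (b - t)) ≤
      ENNReal.ofReal (D * h (b - a)) := by
    refine le_trans (le_of_eq ?_) (hD (b - a) (sub_pos.2 hab) hb)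
    rw [Measure.restrict_congr_set Ioo_ae_eq_Ioc.symm]
    have h2 := (Measure.measurePreserving_sub_left volume b).setLIntegral_comp_preimage_emb
      (MeasurableEquiv.subLeft b).measurableEmbedding
      (fun x => ENNReal.ofReal (h x / x)) (Ioo 0 (b - a))
    rw [← h2]
    congr 2
    ext x
    simp
  calc ∫⁻ t in Ioo a b, ENNReal.ofReal (h (gap E t) / gap E t)
      ≤ ∫⁻ t in Ioo a b, (ENNReal.ofReal (h (t - a) / (t - a)) +
          ENNReal.ofReal (h (b - t) / (b - t))) := by
        refine setLIntegral_mono' measurableSet_Ioo fun t ht => ?_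
        have hta : 0 < t - a := sub_pos.2 ht.1
        have hbt : 0 < b - t := sub_pos.2 ht.2
        have h3 : min (t - a) (b - t) ≤ gap E t := by
          rw [gap, Metric.le_infDist (lift_nonempty hne)]
          intro x hx
          rcases le_or_gt x a with hxa | hxa
          · refine (min_le_left _ _).trans ?_
            rw [Real.dist_eq]
            exact (by linarith : t - a ≤ t - x).trans (le_abs_self _)
          · have hxb : b ≤ x := by
              by_contra! hlt
              exact hdisj x ⟨hxa, hlt⟩ hx
            refine (min_le_right _ _).trans ?_
            rw [Real.dist_eq, abs_sub_comm]
            exact (by linarith : b - t ≤ x - t).trans (le_abs_self _)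
        rcases le_total (t - a) (b - t) with h4 | h4
        · rw [min_eq_left h4] at h3
          exact (ENNReal.ofReal_le_ofReal (hg.r1 hta h3)).trans le_self_add
        · rw [min_eq_right h4] at h3
          exact (ENNReal.ofReal_le_ofReal (hg.r1 hbt h3)).trans le_add_self
    _ = _ := lintegral_add_left (hm.comp (measurable_id.sub_const a)) _
    _ ≤ _ := by
        rw [two_mul]
        exact add_le_add h1 h2

theorem lintegral_gauge_gap_lt_top (hg : IsGauge h) {D : ℝ} (hD0 : 0 ≤ D)
    (hD : ∀ ℓ, 0 < ℓ → ℓ ≤ 2 * Real.pi →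
      ∫⁻ x in Ioc 0 ℓ, ENNReal.ofReal (h x / x) ≤ ENNReal.ofReal (D * h ℓ))
    (hhm : Continuous h) (hne : E.Nonempty) (hE : IsHCarleson h E) :
    ∫⁻ t in Ioc 0 (2 * Real.pi), ENNReal.ofReal (h (gap E t) / gap E t) < ⊤ := by
  obtain ⟨hcl, I, hI, -, hU, hsum⟩ := hE
  obtain ⟨e, he⟩ := lift_nonempty hne
  have hp : Function.Periodic (fun t => ENNReal.ofReal (h (gap E t) / gap E t)) (2 * Real.pi) :=
    fun t => by simp only [periodic_gap t]
  have hshift := lintegral_periodic_Ioc (by positivity) hp 0 e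
  rw [zero_add] at hshift
  rw [hshift]
  set J : ℕ → Set ℝ := fun k => Ioo e (e + 2 * Real.pi) ∩ (fun t : ℝ => (t : UnitCircle)) ⁻¹' I k
    with hJ
  have hIE : ∀ k, I k ⊆ Eᶜ := fun k => hU ▸ subset_iUnion I k
  have hcover : Ioc e (e + 2 * Real.pi) ⊆ (⋃ k, J k) ∪ (lift E ∩ Ioc e (e + 2 * Real.pi)) := by
    intro t ht
    by_cases htE : t ∈ lift E
    · exact Or.inr ⟨htE, ht⟩
    · left
      have h1 : (t : UnitCircle) ∈ ⋃ k, I k := by rw [hU]; exact htE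
      obtain ⟨k, hk⟩ := mem_iUnion.1 h1
      refine mem_iUnion.2 ⟨k, ⟨ht.1, lt_of_le_of_ne ht.2 ?_⟩, hk⟩
      rintro rfl
      exact htE ((add_mem_lift_iff e).2 he)
  have hJbound : ∀ k, ∫⁻ t in J k, ENNReal.ofReal (h (gap E t) / gap E t) ≤
      2 * ENNReal.ofReal D * ENNReal.ofReal (h (volume (I k)).toReal) := by
    intro k
    rcases (J k).eq_empty_or_nonempty with hJe | hJne
    · rw [hJe]
      simp
    have hpre : IsPreconnected (J k) := by
      have hsub : I k ⊆ (AddCircle.openPartialHomeomorphCoe (2 * Real.pi) e).target := by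
        intro x hx hxe
        have hxe' : x = (e : UnitCircle) := hxe
        exact hIE k hx (by rw [hxe']; exact he)
      have h1 := (hI k).2.image (AddCircle.openPartialHomeomorphCoe (2 * Real.pi) e).symm
        ((AddCircle.openPartialHomeomorphCoe (2 * Real.pi) e).continuousOn_symm.mono hsub)
      rwa [OpenPartialHomeomorph.symm_image_eq_source_inter_preimage _ hsub] at h1
    have hbb : BddBelow (J k) := ⟨e, fun t ht => ht.1.1.le⟩
    have hba : BddAbove (J k) := ⟨e + 2 * Real.pi, fun t ht => ht.1.2.le⟩
    have hsub1 : J k ⊆ Icc (sInf (J k)) (sSup (J k)) := fun t ht =>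
      ⟨csInf_le hbb ht, le_csSup hba ht⟩
    have hsub2 : Ioo (sInf (J k)) (sSup (J k)) ⊆ J k :=
      IsConnected.Ioo_csInf_csSup_subset ⟨hJne, hpre⟩ hbb hba
    have hlen : sSup (J k) - sInf (J k) ≤ 2 * Real.pi := by
      have h1 : e ≤ sInf (J k) := le_csInf hJne fun t ht => ht.1.1.le
      have h2 : sSup (J k) ≤ e + 2 * Real.pi := csSup_le hJne fun t ht => ht.1.2.le
      linarith
    refine (lintegral_mono_set hsub1).trans ?_
    rw [Measure.restrict_congr_set Ioo_ae_eq_Icc.symm]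
    rcases le_or_gt (sSup (J k)) (sInf (J k)) with hle | hlt
    · rw [Ioo_eq_empty (not_lt.2 hle)]
      simp
    refine (lintegral_gauge_gap_Ioo_le hg hD hhm hne hlt hlen fun t ht htE =>
      hIE k (hsub2 ht).2 htE).trans ?_
    rw [ENNReal.ofReal_mul hD0, mul_assoc]
    gcongr
    refine hg.mono (sub_pos.2 hlt).le ENNReal.toReal_nonneg ?_
    have hvol : ENNReal.ofReal (sSup (J k) - sInf (J k)) ≤ volume (I k) := by
      rw [← (AddCircle.measurePreserving_mk (2 * Real.pi) e).measure_preimage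
        (hI k).1.measurableSet.nullMeasurableSet, ← Real.volume_Ioo,
        Measure.restrict_apply ((hI k).1.measurableSet.preimage AddCircle.measurable_mk')]
      refine measure_mono fun t ht => ?_
      exact ⟨(hsub2 ht).2, Ioo_subset_Ioc_self (hsub2 ht).1⟩
    rw [← ENNReal.toReal_ofReal (sub_pos.2 hlt).le]
    exact ENNReal.toReal_mono (measure_ne_top _ _) hvol
  calc _ ≤ ∫⁻ t in (⋃ k, J k) ∪ (lift E ∩ Ioc e (e + 2 * Real.pi)),
        ENNReal.ofReal (h (gap E t) / gap E t) := lintegral_mono_set hcover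
    _ ≤ (∫⁻ t in ⋃ k, J k, ENNReal.ofReal (h (gap E t) / gap E t)) +
        ∫⁻ t in lift E ∩ Ioc e (e + 2 * Real.pi), ENNReal.ofReal (h (gap E t) / gap E t) :=
      lintegral_union_le _ _ _
    _ = ∫⁻ t in ⋃ k, J k, ENNReal.ofReal (h (gap E t) / gap E t) := by
      rw [setLIntegral_congr_fun ((isClosed_lift hcl).measurableSet.inter measurableSet_Ioc)
        (g := fun _ => 0) fun t ht => by simp [gap_eq_zero ht.1]]
      simp
    _ ≤ ∑' k, ∫⁻ t in J k, ENNReal.ofReal (h (gap E t) / gap E t) := lintegral_iUnion_le _ _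
    _ ≤ ∑' k, 2 * ENNReal.ofReal D * ENNReal.ofReal (h (volume (I k)).toReal) :=
      ENNReal.tsum_le_tsum hJbound
    _ < ⊤ := by
      rw [ENNReal.tsum_mul_left]
      exact ENNReal.mul_lt_top (by finiteness) hsum

end SplittingSharpness

namespace SplittingSharpness

variable {E : Set UnitCircle} {h : ℝ → ℝ}

/-- Marcinkiewicz's estimate for the distance function. -/
theorem lintegral_marcinkiewicz_lt_top (hcl : IsClosed E) :
    ∫⁻ x in Ioc 0 (2 * Real.pi), (lift E).indicator
      (fun x => ∫⁻ t, ENNReal.ofReal (gap E t / (t - x) ^ 2)) x < ⊤ := by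
  set K : ℝ → ℝ → ENNReal := fun t s =>
    (lift E).indicator (fun _ => 1) (t - s) * ENNReal.ofReal (gap E t / s ^ 2) with hK
  have hgc : Continuous (gap E) := lipschitzWith_gap.continuous
  have hKm : Measurable (Function.uncurry K) := by
    refine Measurable.mul ?_ ?_
    · exact (measurable_const.indicator (isClosed_lift hcl).measurableSet).comp
        (measurable_fst.sub measurable_snd)
    · exact ((hgc.measurable.comp measurable_fst).div (measurable_snd.pow_const 2)).ennreal_ofReal
  have hKp : ∀ s, Function.Periodic (fun t => K t s) (2 * Real.pi) := fun s t => by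
    have h1 : t + 2 * Real.pi - s ∈ lift E ↔ t - s ∈ lift E := by
      rw [add_sub_right_comm, add_mem_lift_iff]
    simp only [hK, periodic_gap t]
    by_cases hs : t - s ∈ lift E
    · rw [indicator_of_mem hs, indicator_of_mem (h1.2 hs)]
    · rw [indicator_of_notMem hs, indicator_of_notMem (h1.not.2 hs)]
  have hun := lintegral_unfold (by positivity) hKm hKp 0
  rw [zero_add] at hun
  have e : ∀ x, (lift E).indicator (fun x => ∫⁻ t, ENNReal.ofReal (gap E t / (t - x) ^ 2)) x =
      ∫⁻ t, K t (t - x) := fun x => by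
    simp only [hK, sub_sub_cancel]
    by_cases hx : x ∈ lift E <;> simp [hx]
  simp_rw [e]
  rw [hun]
  have hin : ∀ t, ∫⁻ s, K t s ≤ ENNReal.ofReal (2 * Real.pi) := by
    intro t
    rcases (gap_nonneg (E := E) t).eq_or_lt with h0 | h0
    · simp [hK, ← h0]
    · calc ∫⁻ s, K t s ≤ ∫⁻ s, ENNReal.ofReal (2 * gap E t) *
            ENNReal.ofReal (1 / (s ^ 2 + gap E t ^ 2)) := by
            refine lintegral_mono fun s => ?_
            simp only [hK]
            by_cases hs : t - s ∈ lift E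
            · have h1 : gap E t ≤ |s| := by
                have := Metric.infDist_le_dist_of_mem (x := t) hs
                rwa [Real.dist_eq, sub_sub_cancel] at this
              have h2 : gap E t ^ 2 ≤ s ^ 2 := by
                rw [← sq_abs s]
                gcongr
              rw [indicator_of_mem hs, one_mul, ← ENNReal.ofReal_mul (by positivity)]
              refine ENNReal.ofReal_le_ofReal ?_
              rw [mul_one_div, div_le_div_iff₀ (by nlinarith) (by positivity)]
              nlinarith
            · simp [hs]
        _ = ENNReal.ofReal (2 * Real.pi) := by
            rw [lintegral_const_mul _ (by fun_prop), lintegral_cauchy_kernel h0,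
              ← ENNReal.ofReal_mul (by positivity)]
            congr 1
            field_simp
  calc _ ≤ ∫⁻ t in Ioc 0 (2 * Real.pi), ENNReal.ofReal (2 * Real.pi) := lintegral_mono hin
    _ < ⊤ := by
      rw [lintegral_const, Measure.restrict_apply_univ, Real.volume_Ioc]
      finiteness

theorem lintegral_gauge_kernel_le (hg : IsGauge h) (hhm : Continuous h) {D : ℝ} (hD0 : 0 ≤ D)
    (hD : ∀ ℓ, 0 < ℓ → ℓ ≤ 2 * Real.pi →
      ∫⁻ x in Ioc 0 ℓ, ENNReal.ofReal (h x / x) ≤ ENNReal.ofReal (D * h ℓ))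
    {a : ℝ} (ha : 0 < a) (haR : a ≤ 2 * Real.pi) :
    ∫⁻ y in Ioc 0 1, ENNReal.ofReal (h y / y * (8 * a) * (2 * Real.pi / max y a ^ 2)) ≤
      ENNReal.ofReal ((16 * Real.pi * D + 32 * Real.pi ^ 2) * (h a / a)) := by
  have hm : Measurable fun x => ENNReal.ofReal (h x / x) :=
    (hhm.measurable.div measurable_id).ennreal_ofReal
  have hka : 0 < h a / a := div_pos (gauge_pos hg ha) ha
  have hsub : Ioc (0 : ℝ) 1 ⊆ Ioc 0 a ∪ Ioi a := fun y hy => by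
    rcases le_or_gt y a with h1 | h1
    · exact Or.inl ⟨hy.1, h1⟩
    · exact Or.inr h1
  refine (lintegral_mono_set hsub).trans ((lintegral_union_le _ _ _).trans ?_)
  rw [add_mul, ENNReal.ofReal_add (by positivity) (by positivity)]
  refine add_le_add ?_ ?_
  · calc _ ≤ ∫⁻ y in Ioc 0 a, ENNReal.ofReal (16 * Real.pi / a) * ENNReal.ofReal (h y / y) := by
          refine setLIntegral_mono' measurableSet_Ioc fun y hy => ?_
          rw [← ENNReal.ofReal_mul (by positivity)]
          refine ENNReal.ofReal_le_ofReal (le_of_eq ?_)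
          rw [max_eq_right hy.2]
          field_simp
          ring
      _ ≤ ENNReal.ofReal (16 * Real.pi / a) * ENNReal.ofReal (D * h a) := by
          rw [lintegral_const_mul _ hm]
          gcongr
          exact hD a ha haR
      _ = _ := by
          rw [← ENNReal.ofReal_mul (by positivity)]
          congr 1
          field_simp
  · calc _ ≤ ∫⁻ y in Ioi a, ENNReal.ofReal (32 * Real.pi * a * (h a / a)) *
          ENNReal.ofReal (1 / (y ^ 2 + a ^ 2)) := by
          refine setLIntegral_mono' measurableSet_Ioi fun y hy => ?_
          have hy' : a < y := hy
          have hy0 : 0 < y := ha.trans hy'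
          rw [← ENNReal.ofReal_mul (by positivity), max_eq_left hy'.le]
          refine ENNReal.ofReal_le_ofReal ?_
          have h1 : 2 * Real.pi / y ^ 2 ≤ 4 * Real.pi * (1 / (y ^ 2 + a ^ 2)) := by
            rw [mul_one_div, div_le_div_iff₀ (by positivity) (by positivity)]
            have : a ^ 2 ≤ y ^ 2 := by gcongr
            nlinarith [Real.pi_pos]
          calc h y / y * (8 * a) * (2 * Real.pi / y ^ 2)
              ≤ h a / a * (8 * a) * (4 * Real.pi * (1 / (y ^ 2 + a ^ 2))) := by
                gcongr ?_ * _ * ?_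
                exact hg.r1 ha hy'.le
            _ = _ := by ring
      _ ≤ ∫⁻ y, ENNReal.ofReal (32 * Real.pi * a * (h a / a)) *
          ENNReal.ofReal (1 / (y ^ 2 + a ^ 2)) := setLIntegral_le_lintegral _ _
      _ = _ := by
          rw [lintegral_const_mul _ (by fun_prop), lintegral_cauchy_kernel ha,
            ← ENNReal.ofReal_mul (by positivity)]
          congr 1
          field_simp

theorem ofReal_potCube_le {σ : ℝ → ℝ} {S : ℝ} (hσ : LipschitzWith 1 σ) (h0 : ∀ t, 0 ≤ σ t)
    (hS : ∀ t, σ t ≤ S) (x : ℝ) {y k : ℝ} (hy : 0 < y) (hk : 0 ≤ k)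
    (hM : pot σ (pt (x, y)) < 1) :
    ENNReal.ofReal (k * potCube σ (pt (x, y))) ≤
      ∫⁻ t, ENNReal.ofReal (k * σ t * (2 / max y (σ t / 8))) *
        ENNReal.ofReal (1 / ((t - x) ^ 2 + max y (σ t / 8) ^ 2)) := by
  rw [potCube, ← integral_const_mul, ofReal_integral_eq_lintegral_ofReal
    ((integrable_potCube hσ.continuous h0 hS (z := pt (x, y)) hy).const_mul k)
    (ae_of_all _ fun t => mul_nonneg hk (div_nonneg (h0 t) (by positivity)))]
  refine lintegral_mono fun t => ?_
  have h1 := le_norm_sub_of_pot_lt_one hσ h0 hS (z := pt (x, y)) hy hM t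
  have h2 : y ≤ ‖(t : ℂ) - pt (x, y)‖ := im_le_norm_ofReal_sub t (pt (x, y))
  have h3 : ‖(t : ℂ) - pt (x, y)‖ ^ 2 = (t - x) ^ 2 + y ^ 2 := by
    rw [← Complex.normSq_eq_norm_sq, Complex.normSq_apply]
    simp only [pt, Complex.sub_re, Complex.sub_im, Complex.ofReal_re, Complex.ofReal_im]
    ring
  have hσt := h0 t
  set r := ‖(t : ℂ) - pt (x, y)‖
  have hb : 0 < max y (σ t / 8) := hy.trans_le (le_max_left _ _)
  have hr : 0 < r := hy.trans_le h2
  have hbr : max y (σ t / 8) ≤ r := max_le h2 (by linarith)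
  have hb2 : (t - x) ^ 2 + max y (σ t / 8) ^ 2 ≤ 2 * r ^ 2 := by
    rcases le_total y (σ t / 8) with h4 | h4
    · rw [max_eq_right h4]
      nlinarith
    · rw [max_eq_left h4]
      nlinarith
  rw [← ENNReal.ofReal_mul (by positivity)]
  refine ENNReal.ofReal_le_ofReal ?_
  rw [mul_assoc k, mul_assoc k]
  refine mul_le_mul_of_nonneg_left ?_ hk
  rw [mul_assoc, div_eq_mul_inv]
  refine mul_le_mul_of_nonneg_left ?_ hσt
  rw [div_mul_div_comm, mul_one, inv_eq_one_div, div_le_div_iff₀ (by positivity) (by positivity),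
    one_mul]
  calc max y (σ t / 8) * ((t - x) ^ 2 + max y (σ t / 8) ^ 2) ≤ r * (2 * r ^ 2) := by gcongr
    _ = 2 * r ^ 3 := by ring

theorem lintegral_potCube_lt_top (hg : IsGauge h) (hhm : Continuous h) {D : ℝ} (hD0 : 0 ≤ D)
    (hD : ∀ ℓ, 0 < ℓ → ℓ ≤ 2 * Real.pi →
      ∫⁻ x in Ioc 0 ℓ, ENNReal.ofReal (h x / x) ≤ ENNReal.ofReal (D * h ℓ))
    (hne : E.Nonempty) (hE : IsHCarleson h E) {δ : ℝ} (hδ : 0 < δ) (hδ1 : δ ≤ 1)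
    {σ : ℝ → ℝ} (hσ : σ = fun t => δ * gap E t) (hLip : LipschitzWith 1 σ)
    (h0 : ∀ t, 0 ≤ σ t) (hS : ∀ t, σ t ≤ 2 * Real.pi) :
    ∫⁻ y in Ioc 0 1, ∫⁻ x in Ioc 0 (2 * Real.pi), (if pot σ (pt (x, y)) < 1 then
      ENNReal.ofReal (h y / y * potCube σ (pt (x, y))) else 0) < ⊤ := by
  have hc : Continuous σ := hLip.continuous
  have hσp : ∀ t, σ (t + 2 * Real.pi) = σ t := fun t => by simp only [hσ, periodic_gap t]
  have hfix : ∀ y ∈ Ioc (0 : ℝ) 1,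
      ∫⁻ x in Ioc 0 (2 * Real.pi), (if pot σ (pt (x, y)) < 1 then
        ENNReal.ofReal (h y / y * potCube σ (pt (x, y))) else 0) ≤
      ∫⁻ t in Ioc 0 (2 * Real.pi),
        ENNReal.ofReal (h y / y * σ t * (2 * Real.pi / max y (σ t / 8) ^ 2)) := by
    intro y hy
    have hk : 0 ≤ h y / y := div_nonneg (gauge_nonneg hg hy.1.le) hy.1.le
    have hbpos : ∀ t, 0 < max y (σ t / 8) := fun t => hy.1.trans_le (le_max_left _ _)
    set K : ℝ → ℝ → ENNReal := fun t s =>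
      ENNReal.ofReal (h y / y * σ t * (2 / max y (σ t / 8))) *
        ENNReal.ofReal (1 / (s ^ 2 + max y (σ t / 8) ^ 2)) with hK
    have hKm : Measurable (Function.uncurry K) := by
      have h1 : Measurable fun q : ℝ × ℝ => σ q.1 := hc.measurable.comp measurable_fst
      have h2 : Measurable fun q : ℝ × ℝ => max y (σ q.1 / 8) :=
        measurable_const.max (h1.div_const 8)
      exact ((h1.const_mul (h y / y)).mul (h2.const_div 2)).ennreal_ofReal.mul
        ((((measurable_snd.pow_const 2).add (h2.pow_const 2)).const_div 1).ennreal_ofReal)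
    have hKp : ∀ s, Function.Periodic (fun t => K t s) (2 * Real.pi) := fun s t => by
      simp only [hK, hσp]
    have hun := lintegral_unfold (by positivity) hKm hKp 0
    rw [zero_add] at hun
    calc _ ≤ ∫⁻ x in Ioc 0 (2 * Real.pi), ∫⁻ t, K t (t - x) := by
          refine lintegral_mono fun x => ?_
          dsimp only
          split_ifs with hM
          · exact ofReal_potCube_le hLip h0 hS x hy.1 hk hM
          · exact zero_le
      _ = ∫⁻ t in Ioc 0 (2 * Real.pi), ∫⁻ s, K t s := hun
      _ = _ := by
          refine lintegral_congr fun t => ?_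
          have hbt := hbpos t
          rw [lintegral_const_mul _ (by fun_prop), lintegral_cauchy_kernel hbt,
            ← ENNReal.ofReal_mul (mul_nonneg (mul_nonneg hk (h0 t)) (by positivity))]
          congr 1
          field_simp
  refine (setLIntegral_mono' measurableSet_Ioc hfix).trans_lt ?_
  rw [lintegral_lintegral_swap]
  swap
  · have h1 : Measurable fun q : ℝ × ℝ => σ q.2 := hc.measurable.comp measurable_snd
    have h2 : Measurable fun q : ℝ × ℝ => max q.1 (σ q.2 / 8) :=
      measurable_fst.max (h1.div_const 8)
    exact ((((hhm.measurable.comp measurable_fst).div measurable_fst).mul h1).mul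
      ((h2.pow_const 2).const_div _)).ennreal_ofReal.aemeasurable
  have hin : ∀ t, ∫⁻ y in Ioc 0 1,
      ENNReal.ofReal (h y / y * σ t * (2 * Real.pi / max y (σ t / 8) ^ 2)) ≤
      ENNReal.ofReal ((16 * Real.pi * D + 32 * Real.pi ^ 2) * (δ / 8)⁻¹) *
        ENNReal.ofReal (h (gap E t) / gap E t) := by
    intro t
    rcases (h0 t).eq_or_lt with hz | hz
    · simp [← hz]
    · have h1 := lintegral_gauge_kernel_le hg hhm hD0 hD (a := σ t / 8) (by positivity)
        (by linarith [hS t, h0 t])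
      rw [mul_div_cancel₀ (σ t) (by norm_num : (8 : ℝ) ≠ 0)] at h1
      refine h1.trans ?_
      rw [← ENNReal.ofReal_mul (by positivity), mul_assoc _ (δ / 8)⁻¹]
      refine ENNReal.ofReal_le_ofReal (mul_le_mul_of_nonneg_left ?_ (by positivity))
      have h2 := gauge_mul_div_le hg (c := δ / 8) (by positivity) (by linarith)
        (gap_nonneg (E := E) t)
      have h3 : σ t / 8 = δ / 8 * gap E t := by rw [hσ]; ring
      rwa [h3]
  refine (lintegral_mono hin).trans_lt ?_
  rw [lintegral_const_mul' _ _ (by finiteness)]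
  exact ENNReal.mul_lt_top (by finiteness) (lintegral_gauge_gap_lt_top hg hD0 hD hhm hne hE)

end SplittingSharpness

namespace SplittingSharpness

/-- Green's identity against a subharmonic test function, cut off at height one. -/
theorem HasJet.integral_bottom_le {u ux uy uxx uyy φ φx φy φxx φyy : ℝ × ℝ → ℝ} {k : ℝ → ℝ}
    {L A K C m τ : ℝ} (hu : HasJet u ux uy uxx uyy) (hφ : HasJet φ φx φy φxx φyy)
    (hφy : ContinuousOn φy {z | 0 < z.2}) (hL : 0 ≤ L)
    (pu : ∀ y, 0 < y → u (L, y) = u (0, y)) (pux : ∀ y, 0 < y → ux (L, y) = ux (0, y))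
    (pφ : ∀ y, 0 < y → φ (L, y) = φ (0, y)) (pφx : ∀ y, 0 < y → φx (L, y) = φx (0, y))
    (hΔu : ∀ z, 0 ≤ uxx z + uyy z) (hΔφ : ∀ z, 0 < z.2 → 0 ≤ φxx z + φyy z)
    (hφ0 : ∀ z, 0 < z.2 → φ z ∈ Icc 0 z.2) (hφ7 : ∀ z, |φy z| ≤ 7)
    (hk : ContinuousOn k (Ioi 0)) (hk0 : ∀ y, 0 < y → 0 ≤ k y) (hC : 0 ≤ C)
    (huk : ∀ x y, 0 < y → y ≤ 1 → u (x, y) ≤ C * k y)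
    (hm : ∀ y, 0 < y → y ≤ 1 → L * m ≤ ∫ x in Icc 0 L, u (x, y)) (hA0 : 0 ≤ A)
    (hA : ∫⁻ y in Ioc 0 1, ∫⁻ x in Ioc 0 L, ENNReal.ofReal (k y * (φxx (x, y) + φyy (x, y))) ≤
      ENNReal.ofReal A)
    (hτ : 0 < τ) (hτ1 : τ ≤ 1) (hK : ∫ y in Icc τ 1, k y ≤ K) :
    ∫ x in Icc 0 L, ((1 - τ) ^ 2 * φ (x, τ) * uy (x, τ) -
        u (x, τ) * (-2 * (1 - τ) * φ (x, τ) + (1 - τ) ^ 2 * φy (x, τ))) ≤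
      C * A + 30 * (2 * C * L * K - L * m * (1 - τ)) := by
  have hc1 : ∀ y : ℝ, HasDerivAt (fun y : ℝ => (1 - y) ^ 2) (-2 * (1 - y)) y := fun y =>
    (((hasDerivAt_id y).const_sub 1).pow 2).congr_deriv (by simp)
  have hc2 : ∀ y : ℝ, HasDerivAt (fun y : ℝ => -2 * (1 - y)) 2 y := fun y =>
    (((hasDerivAt_id y).const_sub 1).const_mul (-2)).congr_deriv (by norm_num)
  have hψ := hφ.mul_snd hφy hc1 hc2 continuous_const
  have green := hu.green hψ hL hτ hτ1 pu pux (fun y hy => by simp only [pφ y hy])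
    (fun y hy => by simp only [pφx y hy])
  dsimp only at green
  set R : Set (ℝ × ℝ) := Icc 0 L ×ˢ Icc τ 1 with hR
  have hRsub : R ⊆ {z | 0 < z.2} := fun z hz => hτ.trans_le hz.2.1
  have hRc : IsCompact R := isCompact_Icc.prod isCompact_Icc
  have hRm : MeasurableSet R := measurableSet_Icc.prod measurableSet_Icc
  have ck : ContinuousOn (fun z : ℝ × ℝ => k z.2) {z | 0 < z.2} :=
    hk.comp continuousOn_snd fun z hz => hz
  have cu := hu.cont
  have cΔu := hu.cont_xx.add hu.cont_yy
  have cΔφ := hφ.cont_xx.add hφ.cont_yy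
  have int : ∀ {F : ℝ × ℝ → ℝ}, ContinuousOn F {z | 0 < z.2} → IntegrableOn F R volume :=
    fun hF => (hF.mono hRsub).integrableOn_compact hRc
  have i1 : IntegrableOn (fun z : ℝ × ℝ => k z.2 * (φxx z + φyy z)) R volume := int (ck.mul cΔφ)
  have i2 : IntegrableOn (fun z : ℝ × ℝ => 2 * C * k z.2 - u z) R volume :=
    int ((continuousOn_const.mul ck).sub cu)
  have i3 : IntegrableOn (fun z : ℝ × ℝ => -(C * (k z.2 * (φxx z + φyy z)))) R volume :=
    (i1.const_mul C).neg
  have i4 : IntegrableOn (fun z : ℝ × ℝ => 30 * (2 * C * k z.2 - u z)) R volume :=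
    i2.const_mul 30
  have lower : -(C * ∫ z in R, k z.2 * (φxx z + φyy z)) - 30 * ∫ z in R, (2 * C * k z.2 - u z) ≤
      ∫ z in R, ((1 - z.2) ^ 2 * φ z * (uxx z + uyy z) - u z *
        ((1 - z.2) ^ 2 * φxx z + ((1 - z.2) ^ 2 * φyy z +
          (2 * φ z + 2 * (-2 * (1 - z.2) * φy z))))) := by
    rw [← integral_const_mul, ← integral_const_mul, ← integral_neg,
      ← integral_sub i3 i4]
    refine setIntegral_mono_on (i3.sub i4) ?_ hRm fun z hz => ?_
    · have c1 : Continuous fun z : ℝ × ℝ => (1 - z.2) ^ 2 := by fun_prop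
      have c2 : Continuous fun z : ℝ × ℝ => -2 * (1 - z.2) := by fun_prop
      exact int (((c1.continuousOn.mul hφ.cont).mul cΔu).sub (cu.mul
        ((c1.continuousOn.mul hφ.cont_xx).add ((c1.continuousOn.mul hφ.cont_yy).add
          ((continuousOn_const.mul hφ.cont).add (continuousOn_const.mul
            (c2.continuousOn.mul hφy)))))))
    · have hz0 : 0 < z.2 := hRsub hz
      have hz1 : z.2 ≤ 1 := hz.2.2
      have hp := hφ0 z hz0
      have hd := hΔφ z hz0
      have hkz := mul_nonneg hC (hk0 z.2 hz0)
      have huz : u z ≤ C * k z.2 := huk z.1 z.2 hz0 hz1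
      have a1 : 0 ≤ (1 - z.2) ^ 2 * φ z * (uxx z + uyy z) :=
        mul_nonneg (mul_nonneg (by positivity) hp.1) (hΔu z)
      have a2 : u z * ((1 - z.2) ^ 2 * (φxx z + φyy z)) ≤ C * (k z.2 * (φxx z + φyy z)) := by
        have hsq : (1 - z.2) ^ 2 ≤ 1 := pow_le_one₀ (by linarith) (by linarith)
        calc u z * ((1 - z.2) ^ 2 * (φxx z + φyy z))
            ≤ C * k z.2 * ((1 - z.2) ^ 2 * (φxx z + φyy z)) :=
              mul_le_mul_of_nonneg_right huz (by positivity)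
          _ ≤ C * k z.2 * (1 * (φxx z + φyy z)) := by gcongr
          _ = _ := by ring
      have a3 : |2 * φ z + 2 * (-2 * (1 - z.2) * φy z)| ≤ 30 := by
        have b1 : |(1 - z.2) * φy z| ≤ 1 * 7 := by
          rw [abs_mul]
          exact mul_le_mul (abs_le.2 ⟨by linarith, by linarith⟩) (hφ7 z) (abs_nonneg _) zero_le_one
        rw [abs_le] at b1 ⊢
        constructor <;> nlinarith [hp.1, hp.2, b1.1, b1.2]
      have a4 : u z * (2 * φ z + 2 * (-2 * (1 - z.2) * φy z)) ≤
          30 * (2 * C * k z.2 - u z) := by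
        rw [abs_le] at a3
        nlinarith [mul_nonneg (sub_nonneg.2 huz) (sub_nonneg.2 a3.1),
          mul_nonneg hkz (sub_nonneg.2 a3.2)]
      nlinarith [a1, a2, a4]
  have b1 : ∫ z in R, k z.2 * (φxx z + φyy z) ≤ A := by
    rw [integral_eq_lintegral_of_nonneg_ae _ i1.aestronglyMeasurable]
    swap
    · filter_upwards [ae_restrict_mem hRm] with z hz
      exact mul_nonneg (hk0 _ (hRsub hz)) (hΔφ z (hRsub hz))
    refine ENNReal.toReal_le_of_le_ofReal hA0 (le_trans ?_ hA)
    have hprod : (volume : Measure (ℝ × ℝ)).restrict R =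
        (volume.restrict (Icc 0 L)).prod (volume.restrict (Icc τ 1)) := by
      rw [Measure.volume_eq_prod, Measure.prod_restrict]
    have hmeas := i1.aestronglyMeasurable.aemeasurable.ennreal_ofReal
    rw [hprod] at hmeas ⊢
    rw [lintegral_prod_symm _ hmeas]
    simp_rw [Measure.restrict_congr_set (Ioc_ae_eq_Icc (a := (0 : ℝ)) (b := L)).symm]
    exact lintegral_mono_set fun y hy => ⟨hτ.trans_le hy.1, hy.2⟩
  have hkI : IntegrableOn k (Icc τ 1) volume :=
    (hk.mono fun y hy => hτ.trans_le hy.1).integrableOn_compact isCompact_Icc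
  have b2 : ∫ z in R, (2 * C * k z.2 - u z) ≤ 2 * C * L * K - L * m * (1 - τ) := by
    have hprod : (volume : Measure (ℝ × ℝ)).restrict R =
        (volume.restrict (Icc 0 L)).prod (volume.restrict (Icc τ 1)) := by
      rw [Measure.volume_eq_prod, Measure.prod_restrict]
    have i2' := i2
    rw [IntegrableOn, hprod] at i2'
    rw [hprod, integral_prod_symm _ i2']
    calc _ ≤ ∫ y in Icc τ 1, (2 * C * L * k y - L * m) := by
          refine setIntegral_mono_on i2'.integral_prod_right
            ((hkI.const_mul _).sub (integrable_const _)) measurableSet_Icc fun y hy => ?_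
          have hy0 : 0 < y := hτ.trans_le hy.1
          have huI : IntegrableOn (fun x => u (x, y)) (Icc 0 L) volume :=
            (continuous_iff_continuousAt.2 fun x =>
              (hu.dx x y hy0).continuousAt).continuousOn.integrableOn_compact isCompact_Icc
          dsimp only
          rw [integral_sub (integrable_const _) huI, setIntegral_const, Measure.real,
            Real.volume_Icc, sub_zero, ENNReal.toReal_ofReal hL, smul_eq_mul]
          have := hm y hy0 hy.2
          linarith
      _ = 2 * C * L * (∫ y in Icc τ 1, k y) - L * m * (1 - τ) := by
          rw [integral_sub (hkI.const_mul _) (integrable_const _), integral_const_mul,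
            setIntegral_const, Measure.real, Real.volume_Icc,
            ENNReal.toReal_ofReal (by linarith), smul_eq_mul]
          ring
      _ ≤ _ := by gcongr
  rw [green] at lower
  have e : ∫ x in Icc 0 L, ((1 - τ) ^ 2 * φ (x, τ) * uy (x, τ) -
        u (x, τ) * (-2 * (1 - τ) * φ (x, τ) + (1 - τ) ^ 2 * φy (x, τ))) =
      -∫ x in Icc 0 L, (((1 - 1) ^ 2 * φ (x, 1) * uy (x, 1) - u (x, 1) *
        (-2 * (1 - 1) * φ (x, 1) + (1 - 1) ^ 2 * φy (x, 1))) -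
        ((1 - τ) ^ 2 * φ (x, τ) * uy (x, τ) - u (x, τ) *
          (-2 * (1 - τ) * φ (x, τ) + (1 - τ) ^ 2 * φy (x, τ)))) := by
    rw [← integral_neg]
    congr 1
    ext x
    ring
  rw [e]
  have := mul_le_mul_of_nonneg_left b1 hC
  linarith

end SplittingSharpness

namespace SplittingSharpness

/-- The limit of `HasJet.integral_bottom_le` as the bottom edge descends to the real line. -/
theorem HasJet.integral_trace_le {u ux uy uxx uyy φ φx φy φxx φyy : ℝ × ℝ → ℝ} {k g : ℝ → ℝ}
    {L A K C m : ℝ} (hu : HasJet u ux uy uxx uyy) (hφ : HasJet φ φx φy φxx φyy)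
    (hφy : ContinuousOn φy {z | 0 < z.2}) (hL : 0 ≤ L) (hu0 : Continuous u) (huy0 : Continuous uy)
    (pu : ∀ y, 0 < y → u (L, y) = u (0, y)) (pux : ∀ y, 0 < y → ux (L, y) = ux (0, y))
    (pφ : ∀ y, 0 < y → φ (L, y) = φ (0, y)) (pφx : ∀ y, 0 < y → φx (L, y) = φx (0, y))
    (hΔu : ∀ z, 0 ≤ uxx z + uyy z) (hΔφ : ∀ z, 0 < z.2 → 0 ≤ φxx z + φyy z)
    (hφ0 : ∀ z, 0 < z.2 → φ z ∈ Icc 0 z.2) (hφ7 : ∀ z, |φy z| ≤ 7)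
    (hk : ContinuousOn k (Ioi 0)) (hk0 : ∀ y, 0 < y → 0 ≤ k y) (hC : 0 ≤ C)
    (huk : ∀ x y, 0 < y → y ≤ 1 → u (x, y) ≤ C * k y)
    (hm : ∀ y, 0 < y → y ≤ 1 → L * m ≤ ∫ x in Icc 0 L, u (x, y)) (hA0 : 0 ≤ A)
    (hA : ∫⁻ y in Ioc 0 1, ∫⁻ x in Ioc 0 L, ENNReal.ofReal (k y * (φxx (x, y) + φyy (x, y))) ≤
      ENNReal.ofReal A)
    (hK : ∀ τ, 0 < τ → ∫ y in Icc τ 1, k y ≤ K)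
    (hg : ∀ᵐ x ∂volume.restrict (Icc 0 L), Tendsto (fun τ => φy (x, τ)) (𝓝[>] 0) (𝓝 (g x))) :
    30 * L * m ≤ C * A + 60 * C * L * K + ∫ x in Icc 0 L, u (x, 0) * g x := by
  have hcpt : IsCompact (Icc 0 L ×ˢ Icc (0 : ℝ) 1) := isCompact_Icc.prod isCompact_Icc
  obtain ⟨B, hB⟩ := hcpt.exists_bound_of_continuousOn hu0.continuousOn
  obtain ⟨B', hB'⟩ := hcpt.exists_bound_of_continuousOn huy0.continuousOn
  have hsmall : ∀ᶠ τ : ℝ in 𝓝[>] 0, 0 < τ ∧ τ ≤ 1 :=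
    Ioc_mem_nhdsGT (zero_lt_one (α := ℝ))
  have hid : Tendsto (fun τ : ℝ => τ) (𝓝[>] 0) (𝓝 0) := tendsto_id.mono_left nhdsWithin_le_nhds
  have h1τ : Tendsto (fun τ : ℝ => 1 - τ) (𝓝[>] 0) (𝓝 1) := by
    simpa using hid.const_sub (1 : ℝ)
  have hlim : Tendsto (fun τ => ∫ x in Icc 0 L, ((1 - τ) ^ 2 * φ (x, τ) * uy (x, τ) -
        u (x, τ) * (-2 * (1 - τ) * φ (x, τ) + (1 - τ) ^ 2 * φy (x, τ)))) (𝓝[>] 0)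
      (𝓝 (∫ x in Icc 0 L, -(u (x, 0) * g x))) := by
    refine tendsto_integral_filter_of_dominated_convergence (fun _ => B' + B * 9) ?_ ?_
      (integrable_const _) ?_
    · filter_upwards [hsmall] with τ hτ
      have c1 : Continuous fun x => φ (x, τ) :=
        continuous_iff_continuousAt.2 fun x => (hφ.dx x τ hτ.1).continuousAt
      have c2 : Continuous fun x => φy (x, τ) :=
        hφy.comp_continuous (f := fun x => (x, τ)) (by fun_prop) fun x => hτ.1
      have c3 : Continuous fun x => u (x, τ) := hu0.comp (by fun_prop)
      have c4 : Continuous fun x => uy (x, τ) := huy0.comp (by fun_prop)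
      exact (((continuous_const.mul c1).mul c4).sub (c3.mul ((continuous_const.mul c1).add
        (continuous_const.mul c2)))).aestronglyMeasurable
    · filter_upwards [hsmall] with τ hτ
      filter_upwards [ae_restrict_mem measurableSet_Icc] with x hx
      have hz : (x, τ) ∈ Icc 0 L ×ˢ Icc (0 : ℝ) 1 := ⟨hx, hτ.1.le, hτ.2⟩
      have b := hB _ hz
      have b' := hB' _ hz
      have p := hφ0 (x, τ) hτ.1
      have p1 : |φ (x, τ)| ≤ 1 := abs_le.2 ⟨by linarith [p.1], p.2.trans hτ.2⟩
      have q : |1 - τ| ≤ 1 := abs_le.2 ⟨by linarith, by linarith⟩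
      have q2 : |(1 - τ) ^ 2| ≤ 1 := by rw [abs_pow]; exact pow_le_one₀ (abs_nonneg _) q
      refine (norm_sub_le _ _).trans (add_le_add ?_ ?_)
      · rw [norm_mul, norm_mul]
        calc _ ≤ 1 * 1 * B' := by gcongr <;> assumption
          _ = _ := by ring
      · rw [norm_mul]
        refine mul_le_mul b ?_ (norm_nonneg _) ((norm_nonneg _).trans b)
        calc _ ≤ ‖-2 * (1 - τ) * φ (x, τ)‖ + ‖(1 - τ) ^ 2 * φy (x, τ)‖ := norm_add_le _ _
          _ ≤ 2 * 1 * 1 + 1 * 7 := by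
            simp only [norm_mul, Real.norm_eq_abs, abs_neg, abs_two]
            gcongr
            exact hφ7 _
          _ = 9 := by norm_num
    · filter_upwards [hg] with x hx
      have cu : Tendsto (fun τ => u (x, τ)) (𝓝[>] 0) (𝓝 (u (x, 0))) :=
        ((hu0.comp (by fun_prop : Continuous fun τ : ℝ => (x, τ))).tendsto 0).mono_left
          nhdsWithin_le_nhds
      have cuy : Tendsto (fun τ => uy (x, τ)) (𝓝[>] 0) (𝓝 (uy (x, 0))) :=
        ((huy0.comp (by fun_prop : Continuous fun τ : ℝ => (x, τ))).tendsto 0).mono_left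
          nhdsWithin_le_nhds
      have cφ : Tendsto (fun τ => φ (x, τ)) (𝓝[>] 0) (𝓝 0) :=
        tendsto_of_tendsto_of_tendsto_of_le_of_le' tendsto_const_nhds hid
          (hsmall.mono fun τ hτ => (hφ0 (x, τ) hτ.1).1)
          (hsmall.mono fun τ hτ => (hφ0 (x, τ) hτ.1).2)
      have := (((h1τ.pow 2).mul cφ).mul cuy).sub
        (cu.mul (((h1τ.const_mul (-2)).mul cφ).add ((h1τ.pow 2).mul hx)))
      simpa using this
  have hrhs : Tendsto (fun τ => C * A + 30 * (2 * C * L * K - L * m * (1 - τ))) (𝓝[>] 0)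
      (𝓝 (C * A + 30 * (2 * C * L * K - L * m * 1))) :=
    (((h1τ.const_mul (L * m)).const_sub _).const_mul 30).const_add _
  have := le_of_tendsto_of_tendsto hlim hrhs (hsmall.mono fun τ hτ =>
    hu.integral_bottom_le hφ hφy hL pu pux pφ pφx hΔu hΔφ hφ0 hφ7 hk hk0 hC huk hm hA0 hA hτ.1 hτ.2
      (hK τ hτ.1))
  rw [integral_neg] at this
  linarith

variable {σ : ℝ → ℝ} {S : ℝ}

theorem tendsto_testFnY_zero (hσ : LipschitzWith 1 σ) (h0 : ∀ t, 0 ≤ σ t) (hS : ∀ t, σ t ≤ S)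
    {x : ℝ} (hx : 0 < σ x) : Tendsto (fun y => testFnY σ (x, y)) (𝓝[>] 0) (𝓝 0) := by
  refine tendsto_const_nhds.congr' ?_
  filter_upwards [Ioo_mem_nhdsGT (show 0 < σ x / 4 by positivity)] with y hy
  have hM : 1 ≤ pot σ (pt (x, y)) := by
    by_contra! hM
    have h1 := le_norm_sub_of_pot_lt_one hσ h0 hS (z := pt (x, y)) hy.1 hM x
    have h2 : ‖(x : ℂ) - pt (x, y)‖ = y := by
      have : (x : ℂ) - pt (x, y) = -(y * Complex.I) := by
        apply Complex.ext <;> simp [pt]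
      rw [this, norm_neg, norm_mul, Complex.norm_I, mul_one, Complex.norm_real, Real.norm_eq_abs,
        abs_of_pos hy.1]
    linarith [hy.2]
  simp [testFnY, cut_eq_zero hM, cut'_eq_zero hM]

theorem tendsto_testFnY_cut (hσ : Continuous σ) (h0 : ∀ t, 0 ≤ σ t) {x : ℝ}
    (hx : Integrable fun t => σ t / (t - x) ^ 2) :
    Tendsto (fun y => testFnY σ (x, y)) (𝓝[>] 0) (𝓝 (cut (∫ t, σ t / (t - x) ^ 2))) := by
  have hne : ∀ᵐ t : ℝ, t ≠ x := by simp [ae_iff]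
  have hle : ∀ y t : ℝ, t ≠ x → σ t / ‖(t : ℂ) - pt (x, y)‖ ^ 2 ≤ σ t / (t - x) ^ 2 := by
    intro y t ht
    have h1 : 0 < (t - x) ^ 2 := by have := sub_ne_zero.2 ht; positivity
    refine div_le_div_of_nonneg_left (h0 t) h1 ?_
    rw [← Complex.normSq_eq_norm_sq, Complex.normSq_apply]
    simp only [pt, Complex.sub_re, Complex.ofReal_re, Complex.sub_im, Complex.ofReal_im]
    nlinarith [sq_nonneg y]
  have hpt : Tendsto (fun y : ℝ => pt (x, y)) (𝓝[>] 0) (𝓝 (x : ℂ)) := by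
    have h1 : Continuous fun y : ℝ => pt (x, y) := continuous_pt.comp (by fun_prop)
    have h2 := (h1.tendsto 0).mono_left (nhdsWithin_le_nhds (s := Ioi 0))
    exact h2
  have hsub : ∀ t : ℝ, Tendsto (fun y : ℝ => (t : ℂ) - pt (x, y)) (𝓝[>] 0) (𝓝 ((t : ℂ) - x)) :=
    fun t => hpt.const_sub _
  have cpt : ∀ y : ℝ, Measurable fun t : ℝ => (t : ℂ) - pt (x, y) := fun y =>
    (Complex.continuous_ofReal.sub continuous_const).measurable
  have hpot : Tendsto (fun y => pot σ (pt (x, y))) (𝓝[>] 0) (𝓝 (∫ t, σ t / (t - x) ^ 2)) := by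
    refine tendsto_integral_filter_of_dominated_convergence _ (Eventually.of_forall fun y => ?_)
      (Eventually.of_forall fun y => ?_) hx ?_
    · exact (hσ.measurable.div ((cpt y).norm.pow_const 2)).aestronglyMeasurable
    · filter_upwards [hne] with t ht
      rw [Real.norm_eq_abs, abs_of_nonneg (div_nonneg (h0 t) (by positivity))]
      exact hle y t ht
    · filter_upwards [hne] with t ht
      have h1 := ((hsub t).norm.pow 2)
      rw [← Complex.ofReal_sub, Complex.norm_real, Real.norm_eq_abs, sq_abs] at h1
      exact tendsto_const_nhds.div h1 (pow_ne_zero 2 (sub_ne_zero.2 ht))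
  have hher : Tendsto (fun y => herglotz' σ (pt (x, y))) (𝓝[>] 0)
      (𝓝 ((∫ t, σ t / (t - x) ^ 2 : ℝ) : ℂ)) := by
    rw [← integral_complex_ofReal]
    refine tendsto_integral_filter_of_dominated_convergence _ (Eventually.of_forall fun y => ?_)
      (Eventually.of_forall fun y => ?_) hx ?_
    · exact ((Complex.continuous_ofReal.comp hσ).measurable.div
        ((cpt y).pow_const 2)).aestronglyMeasurable
    · filter_upwards [hne] with t ht
      rw [norm_herglotz'_integrand h0]
      exact hle y t ht
    · filter_upwards [hne] with t ht
      have h2 : ((t : ℂ) - x) ^ 2 ≠ 0 :=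
        pow_ne_zero 2 (sub_ne_zero.2 (Complex.ofReal_injective.ne ht))
      have h1 := (tendsto_const_nhds (x := (σ t : ℂ))).div ((hsub t).pow 2) h2
      push_cast
      exact h1
  have hre := (Complex.continuous_re.tendsto _).comp hher
  have := ((continuous_cut.tendsto _).comp hpot).add
    (((continuous_cut'.tendsto _).comp hpot).mul (hre.sub hpot))
  simpa [testFnY] using this

end SplittingSharpness

namespace SplittingSharpness

variable {E : Set UnitCircle} {h : ℝ → ℝ}

/-- The boundary trace on the real line of the vertical derivative of the test function attached
to `δ * gap E`. -/
def traceFn (E : Set UnitCircle) (δ : ℝ) : ℝ → ℝ :=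
  (lift E).indicator fun x => cut (∫ t, δ * gap E t / (t - x) ^ 2)

theorem integral_gap_nonneg {δ : ℝ} (hδ : 0 ≤ δ) (x : ℝ) : 0 ≤ ∫ t, δ * gap E t / (t - x) ^ 2 :=
  integral_nonneg fun t => div_nonneg (mul_nonneg hδ (gap_nonneg t)) (sq_nonneg _)

theorem traceFn_mem_Icc {δ : ℝ} (hδ : 0 ≤ δ) (x : ℝ) : traceFn E δ x ∈ Icc (0 : ℝ) 1 := by
  unfold traceFn indicator
  split_ifs
  · exact cut_mem_Icc (integral_gap_nonneg hδ x)
  · simp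

theorem measurable_traceFn (hcl : IsClosed E) (δ : ℝ) : Measurable (traceFn E δ) := by
  refine Measurable.indicator ?_ (isClosed_lift hcl).measurableSet
  refine continuous_cut.measurable.comp (StronglyMeasurable.integral_prod_right
    (f := fun x t => δ * gap E t / (t - x) ^ 2) ?_).measurable
  have hgc : Continuous (gap E) := lipschitzWith_gap.continuous
  exact (((hgc.measurable.comp measurable_snd).const_mul δ).div
    ((measurable_snd.sub measurable_fst).pow_const 2)).stronglyMeasurable

theorem integrableOn_traceFn (hcl : IsClosed E) {δ : ℝ} (hδ : 0 ≤ δ) :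
    IntegrableOn (traceFn E δ) (Icc 0 (2 * Real.pi)) := by
  refine (integrable_const (1 : ℝ)).mono' (measurable_traceFn hcl δ).aestronglyMeasurable
    (ae_of_all _ fun x => ?_)
  rw [Real.norm_eq_abs, abs_of_nonneg (traceFn_mem_Icc hδ x).1]
  exact (traceFn_mem_Icc hδ x).2

theorem volume_lift_inter (hcl : IsClosed E) :
    volume (lift E ∩ Ioc 0 (2 * Real.pi)) = volume E := by
  have h1 := (AddCircle.measurePreserving_mk (2 * Real.pi) 0).measure_preimage
    hcl.measurableSet.nullMeasurableSet
  rw [zero_add] at h1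
  rw [← h1]
  exact (Measure.restrict_apply (isClosed_lift hcl).measurableSet).symm

theorem exists_integral_traceFn_pos (hcl : IsClosed E) (hpos : 0 < volume E) :
    ∃ δ : ℝ, 0 < δ ∧ δ ≤ 1 ∧ 0 < ∫ x in Icc 0 (2 * Real.pi), traceFn E δ x := by
  set J : ℝ → ℝ := fun x => ∫ t, gap E t / (t - x) ^ 2 with hJ
  have hunion : lift E ∩ Ioc 0 (2 * Real.pi) ⊆
      ⋃ n : ℕ, {x | x ∈ lift E ∩ Ioc 0 (2 * Real.pi) ∧ J x < n + 1} := fun x hx => by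
    obtain ⟨n, hn⟩ := exists_nat_gt (J x)
    exact mem_iUnion.2 ⟨n, hx, by linarith⟩
  obtain ⟨n, hn⟩ := exists_measure_pos_of_not_measure_iUnion_null
    (((volume_lift_inter hcl).symm ▸ hpos).trans_le (measure_mono hunion)).ne'
  have hn1 : (1 : ℝ) ≤ n + 1 := by linarith [n.cast_nonneg (α := ℝ)]
  have hδ : 0 < (1 : ℝ) / (n + 1) := by positivity
  refine ⟨1 / (n + 1), hδ, (div_le_one (by positivity)).2 hn1, ?_⟩
  rw [setIntegral_pos_iff_support_of_nonneg_ae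
    (ae_of_all _ fun x => (traceFn_mem_Icc hδ.le x).1) (integrableOn_traceFn hcl hδ.le)]
  refine hn.trans_le (measure_mono fun x hx => ⟨?_, Ioc_subset_Icc_self hx.1.2⟩)
  have h1 : ∫ t, 1 / ((n : ℝ) + 1) * gap E t / (t - x) ^ 2 = 1 / (n + 1) * J x := by
    rw [hJ, ← integral_const_mul]
    simp_rw [mul_div_assoc]
  have h2 : 1 / ((n : ℝ) + 1) * J x < 1 := by
    rw [one_div, inv_mul_lt_iff₀ (by positivity), mul_one]
    exact hx.2
  rw [Function.mem_support, traceFn, indicator_of_mem hx.1.1, h1, cut]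
  exact pow_ne_zero 3 (lt_max_of_lt_right (by linarith)).ne'

theorem ae_tendsto_testFnY (hcl : IsClosed E) (hne : E.Nonempty) {δ : ℝ} (hδ : 0 < δ)
    (hLip : LipschitzWith 1 fun t => δ * gap E t) {S : ℝ} (hS : ∀ t, δ * gap E t ≤ S) :
    ∀ᵐ x ∂volume.restrict (Icc 0 (2 * Real.pi)),
      Tendsto (fun y => testFnY (fun t => δ * gap E t) (x, y)) (𝓝[>] 0) (𝓝 (traceFn E δ x)) := by
  have h0 : ∀ t, 0 ≤ δ * gap E t := fun t => mul_nonneg hδ.le (gap_nonneg t)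
  have hgc : Continuous (gap E) := lipschitzWith_gap.continuous
  rw [Measure.restrict_congr_set (Ioc_ae_eq_Icc (a := (0 : ℝ)) (b := 2 * Real.pi)).symm]
  have hmeas : Measurable fun x : ℝ => ∫⁻ t, ENNReal.ofReal (gap E t / (t - x) ^ 2) :=
    Measurable.lintegral_prod_right' (f := fun q : ℝ × ℝ =>
      ENNReal.ofReal (gap E q.2 / (q.2 - q.1) ^ 2))
      ((hgc.measurable.comp measurable_snd).div
        ((measurable_snd.sub measurable_fst).pow_const 2)).ennreal_ofReal
  filter_upwards [ae_lt_top (hmeas.indicator (isClosed_lift hcl).measurableSet)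
    (lintegral_marcinkiewicz_lt_top hcl).ne] with x hx
  by_cases hxE : x ∈ lift E
  · rw [indicator_of_mem hxE] at hx
    rw [traceFn, indicator_of_mem hxE]
    refine tendsto_testFnY_cut hLip.continuous h0 ?_
    have hi : Integrable fun t => gap E t / (t - x) ^ 2 := by
      refine ⟨(hgc.measurable.div
        ((measurable_id.sub_const x).pow_const 2)).aestronglyMeasurable, ?_⟩
      rwa [hasFiniteIntegral_iff_ofReal
        (ae_of_all _ fun t => div_nonneg (gap_nonneg t) (sq_nonneg _))]
    simpa only [mul_div_assoc] using hi.const_mul δ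
  · rw [traceFn, indicator_of_notMem hxE]
    exact tendsto_testFnY_zero hLip h0 hS (mul_pos hδ (gap_pos hcl hne hxE))

/-- An entire periodic function dominated by the gauge near the real line cannot be much smaller
than its mean on an `h`-Carleson set of positive measure. -/
theorem exists_regLog_bound (hg : IsGauge h) (hhm : Continuous h) {D : ℝ} (hD0 : 0 ≤ D)
    (hD : ∀ ℓ, 0 < ℓ → ℓ ≤ 2 * Real.pi →
      ∫⁻ x in Ioc 0 ℓ, ENNReal.ofReal (h x / x) ≤ ENNReal.ofReal (D * h ℓ))
    (hE : IsHCarleson h E) (hpos : 0 < volume E) :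
    ∃ g : ℝ → ℝ, Measurable g ∧ (∀ x, g x ∈ Icc (0 : ℝ) 1) ∧ (∀ x, x ∉ lift E → g x = 0) ∧
      0 < ∫ x in Icc 0 (2 * Real.pi), g x ∧ ∃ A : ℝ, ∀ (C m η : ℝ) (f : ℂ → ℂ), 0 ≤ C → 0 < η →
      Differentiable ℂ f → Function.Periodic f ((2 * Real.pi : ℝ) : ℂ) →
      (∀ x y, 0 < y → y ≤ 1 → regLog f η (pt (x, y)) ≤ C * (h y / y)) →
      (∀ y, 0 < y → y ≤ 1 →
        2 * Real.pi * m ≤ ∫ x in Icc 0 (2 * Real.pi), regLog f η (pt (x, y))) →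
      60 * Real.pi * m ≤ C * A + ∫ x in Icc 0 (2 * Real.pi), regLog f η x * g x := by
  have hcl := hE.1
  have hne : E.Nonempty := nonempty_of_measure_ne_zero hpos.ne'
  obtain ⟨δ, hδ, hδ1, hδi⟩ := exists_integral_traceFn_pos hcl hpos
  refine ⟨traceFn E δ, measurable_traceFn hcl δ, traceFn_mem_Icc hδ.le,
    fun x hx => indicator_of_notMem hx _, hδi, ?_⟩
  set σ : ℝ → ℝ := fun t => δ * gap E t with hσ
  have h0 : ∀ t, 0 ≤ σ t := fun t => mul_nonneg hδ.le (gap_nonneg t)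
  have hS : ∀ t, σ t ≤ 2 * Real.pi := fun t =>
    (mul_le_of_le_one_left (gap_nonneg t) hδ1).trans (gap_le hne t)
  have hLip : LipschitzWith 1 σ := LipschitzWith.of_dist_le_mul fun s t => by
    have := (lipschitzWith_gap (E := E)).dist_le_mul s t
    simp only [NNReal.coe_one, one_mul, Real.dist_eq] at this ⊢
    rw [hσ, ← mul_sub, abs_mul, abs_of_pos hδ]
    exact (mul_le_of_le_one_left (abs_nonneg _) hδ1).trans this
  have hper : Function.Periodic σ (2 * Real.pi) := fun t => by
    simp only [hσ, periodic_gap t]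
  obtain ⟨φx, φxx, φyy, hφ, hφy, pφ, pφx, hΔ⟩ := exists_hasJet_testFn hLip.continuous h0 hS hper
  have hfin := lintegral_potCube_lt_top hg hhm hD0 hD hne hE hδ hδ1 hσ hLip h0 hS
  set I := ∫⁻ y in Ioc 0 1, ∫⁻ x in Ioc 0 (2 * Real.pi), (if pot σ (pt (x, y)) < 1 then
      ENNReal.ofReal (h y / y * potCube σ (pt (x, y))) else 0) with hI
  have hk0 : ∀ y, 0 < y → 0 ≤ h y / y := fun y hy => (div_pos (gauge_pos hg hy) hy).le
  have hk : ContinuousOn (fun y => h y / y) (Ioi 0) :=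
    hhm.continuousOn.div continuousOn_id fun y hy => (mem_Ioi.1 hy).ne'
  have hA : ∫⁻ y in Ioc 0 1, ∫⁻ x in Ioc 0 (2 * Real.pi),
      ENNReal.ofReal (h y / y * (φxx (x, y) + φyy (x, y))) ≤ ENNReal.ofReal (24 * I.toReal) := by
    rw [ENNReal.ofReal_mul (by norm_num), ENNReal.ofReal_toReal hfin.ne, hI,
      ← lintegral_const_mul' _ _ ENNReal.ofReal_ne_top]
    refine setLIntegral_mono' measurableSet_Ioc fun y hy => ?_
    rw [← lintegral_const_mul' _ _ ENNReal.ofReal_ne_top]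
    refine lintegral_mono fun x => ?_
    have h1 := (hΔ (x, y) hy.1).2
    have h2 := hk0 y hy.1
    split_ifs at h1 ⊢ with h3
    · rw [← ENNReal.ofReal_mul (by norm_num)]
      refine ENNReal.ofReal_le_ofReal ?_
      nlinarith [mul_le_mul_of_nonneg_left h1 h2]
    · rw [ENNReal.ofReal_of_nonpos (mul_nonpos_of_nonneg_of_nonpos h2 h1)]
      exact bot_le
  have hK : ∀ τ, 0 < τ → ∫ y in Icc τ 1, h y / y ≤ D * h 1 := fun τ hτ => by
    have hsub : Icc τ 1 ⊆ Ioc (0 : ℝ) 1 := fun y hy => ⟨hτ.trans_le hy.1, hy.2⟩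
    rw [integral_eq_lintegral_of_nonneg_ae]
    · refine ENNReal.toReal_le_of_le_ofReal (mul_nonneg hD0 (gauge_pos hg one_pos).le)
        ((lintegral_mono_set hsub).trans (hD 1 one_pos ?_))
      linarith [Real.pi_gt_three]
    · filter_upwards [ae_restrict_mem measurableSet_Icc] with y hy
      exact hk0 y (hsub hy).1
    · exact (hhm.measurable.div measurable_id).aestronglyMeasurable
  refine ⟨24 * I.toReal + 120 * Real.pi * (D * h 1), fun C m η f hC hη hf hfp hfk hm => ?_⟩
  obtain ⟨ux, uy, uxx, uyy, hu, pux, huy, hΔu⟩ := exists_hasJet_regLog hf hη hfp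
  have hcont : Continuous fun z => regLog f η (pt z) :=
    (continuous_regLog hf.continuous hη).comp continuous_pt
  have pu : ∀ y, regLog f η (pt (2 * Real.pi, y)) = regLog f η (pt (0, y)) := fun y => by
    have : pt (2 * Real.pi, y) = pt (0, y) + ((2 * Real.pi : ℝ) : ℂ) := by
      apply Complex.ext <;> simp [pt]
    rw [regLog, this, hfp, regLog]
  have := hu.integral_trace_le hφ hφy (by positivity) hcont huy (fun y _ => pu y)
    (fun y _ => pux y) (fun y _ => pφ y) (fun y _ => pφx y) hΔu (fun z hz => (hΔ z hz).1)
    (fun z hz => testFn_mem_Icc h0 hz) (abs_testFnY_le h0) hk hk0 hC hfk hm (by positivity) hA hK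
    (ae_tendsto_testFnY hcl hne hδ hLip hS)
  have e : ∀ x : ℝ, pt (x, 0) = x := fun x => rfl
  simp only [e] at this
  linarith

end SplittingSharpness

namespace SplittingSharpness

theorem log_norm_le_circleAverage {f : ℂ → ℂ} {R : ℝ} (hR : 0 < R) (hf : Differentiable ℂ f)
    (h0 : f 0 ≠ 0) : Real.log ‖f 0‖ ≤ Real.circleAverage (Real.log ‖f ·‖) 0 R := by
  have han : AnalyticOnNhd ℂ f (Metric.closedBall 0 |R|) := fun z _ => hf.analyticAt z
  rw [han.circleAverage_log_norm hR.ne' h0]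
  refine le_add_of_nonneg_left (finsum_nonneg fun u => ?_)
  by_cases hu : u ∈ Metric.closedBall (0 : ℂ) |R|
  · refine mul_nonneg (mod_cast MeromorphicOn.AnalyticOnNhd.divisor_nonneg han u) ?_
    rcases eq_or_ne u 0 with rfl | hu0
    · simp
    · refine Real.log_nonneg ?_
      rw [zero_sub, norm_neg, ← div_eq_mul_inv, one_le_div (norm_pos_iff.2 hu0)]
      rwa [mem_closedBall_zero_iff, abs_of_pos hR] at hu
  · rw [Function.locallyFinsuppWithin.apply_eq_zero_of_notMem _ hu]
    simp

theorem log_norm_le_regLog {f : ℂ → ℂ} {η : ℝ} (hη : 0 ≤ η) {z : ℂ} (hz : f z ≠ 0) :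
    Real.log ‖f z‖ ≤ regLog f η z := by
  have h1 : (f z).re ^ 2 + (f z).im ^ 2 = ‖f z‖ ^ 2 := by
    rw [← Complex.normSq_eq_norm_sq, Complex.normSq_apply]
    ring
  have h2 : 0 < ‖f z‖ := norm_pos_iff.2 hz
  rw [regLog, h1, le_div_iff₀ two_pos, mul_comm]
  calc 2 * Real.log ‖f z‖ = Real.log (‖f z‖ ^ 2) := by rw [Real.log_pow]; norm_num
    _ ≤ _ := Real.log_le_log (by positivity) (by linarith)

theorem exp_pt_mul_I (x y : ℝ) :
    Complex.exp (pt (x, y) * Complex.I) = circleMap 0 (Real.exp (-y)) x := by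
  have : pt (x, y) * Complex.I = (-y : ℝ) + x * Complex.I := by
    apply Complex.ext <;> simp [pt]
  rw [this, Complex.exp_add, circleMap, zero_add, Complex.ofReal_exp]

theorem norm_exp_pt_mul_I (x y : ℝ) : ‖Complex.exp (pt (x, y) * Complex.I)‖ = Real.exp (-y) := by
  rw [exp_pt_mul_I, norm_circleMap_zero, abs_of_pos (Real.exp_pos _)]

theorem log_eval_zero_le_integral_regLog {q : Polynomial ℂ} (hq : q.eval 0 ≠ 0) {η : ℝ}
    (hη : 0 < η) (y : ℝ) :
    2 * Real.pi * Real.log ‖q.eval 0‖ ≤ ∫ x in Icc 0 (2 * Real.pi),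
      regLog (fun ζ => q.eval (Complex.exp (ζ * Complex.I))) η (pt (x, y)) := by
  set f : ℂ → ℂ := fun ζ => q.eval (Complex.exp (ζ * Complex.I)) with hf
  have hq0 : q ≠ 0 := fun h => hq (by simp [h])
  have hR := Real.exp_pos (-y)
  have hqd : Differentiable ℂ fun z => q.eval z := q.differentiable
  have hfc : Continuous f := by fun_prop
  have h1 := log_norm_le_circleAverage hR hqd hq
  rw [Real.circleAverage_def, smul_eq_mul, ← div_eq_inv_mul, le_div_iff₀ (by positivity),
    intervalIntegral.integral_of_le (by positivity), mul_comm] at h1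
  rw [integral_Icc_eq_integral_Ioc]
  refine h1.trans (integral_mono_ae ?_ ?_ ?_)
  · have hmer : MeromorphicOn (fun z => q.eval z) (Metric.sphere 0 |Real.exp (-y)|) :=
      fun z _ => (hqd.analyticAt z).meromorphicAt
    have := hmer.circleIntegrable_log_norm
    rw [CircleIntegrable, intervalIntegrable_iff_integrableOn_Ioc_of_le (by positivity)] at this
    exact this
  · exact (((continuous_regLog hfc hη).comp (continuous_pt.comp
      (by fun_prop : Continuous fun x : ℝ => (x, y)))).continuousOn.integrableOn_compact
        isCompact_Icc).mono_set Ioc_subset_Icc_self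
  · have hcount : (circleMap 0 (Real.exp (-y)) ⁻¹' {z | q.eval z = 0}).Countable :=
      Set.Countable.preimage_circleMap (Polynomial.finite_setOfPred_isRoot hq0).countable 0 hR.ne'
    filter_upwards [ae_restrict_of_ae (compl_mem_ae_iff.2 (hcount.measure_zero volume))] with x hx
    have hfx : f (pt (x, y)) = q.eval (circleMap 0 (Real.exp (-y)) x) := by
      simp only [hf, exp_pt_mul_I]
    rw [← hfx]
    exact log_norm_le_regLog hη.le (by rw [hfx]; exact hx)

theorem half_le_one_sub_exp_neg {y : ℝ} (hy : 0 < y) (hy1 : y ≤ 1) :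
    y / 2 ≤ 1 - Real.exp (-y) := by
  have h1 : Real.exp (-y) ≤ (1 + y)⁻¹ := by
    rw [Real.exp_neg]
    exact inv_anti₀ (by positivity) (by linarith [Real.add_one_le_exp y])
  have h2 : (1 + y)⁻¹ ≤ 1 - y / 2 := by
    rw [inv_le_iff_one_le_mul₀ (by positivity)]
    nlinarith
  linarith

variable {h : ℝ → ℝ}

theorem regLog_le_gauge (hg : IsGauge h) {C ε : ℝ} (hC : 1 ≤ C) (hε : 0 ≤ ε) {q : Polynomial ℂ}
    (hq : ∀ z : ℂ, 1 / 3 ≤ ‖z‖ → ‖z‖ < 1 →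
      ‖q.eval z‖ ≤ C * Real.exp (ε * (h (1 - ‖z‖) / (1 - ‖z‖))))
    {η : ℝ} (hη : 0 < η) (hη1 : η ≤ 1) (x : ℝ) {y : ℝ} (hy : 0 < y) (hy1 : y ≤ 1) :
    regLog (fun ζ => q.eval (Complex.exp (ζ * Complex.I))) η (pt (x, y)) ≤
      ((1 + Real.log C) / h 1 + 2 * ε) * (h y / y) := by
  have hn := norm_exp_pt_mul_I x y
  have h13 : 1 / 3 ≤ Real.exp (-y) := by
    refine le_trans ?_ (Real.exp_le_exp.2 (neg_le_neg hy1))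
    rw [Real.exp_neg, one_div]
    exact inv_anti₀ (Real.exp_pos _) Real.exp_one_lt_three.le
  have hb := hq (Complex.exp (pt (x, y) * Complex.I)) (hn ▸ h13)
    (hn ▸ Real.exp_lt_one_iff.2 (neg_lt_zero.2 hy))
  rw [hn] at hb
  have hhalf := half_le_one_sub_exp_neg hy hy1
  have hk2 : h (1 - Real.exp (-y)) / (1 - Real.exp (-y)) ≤ 2 * (h y / y) := by
    refine (hg.r1 (by positivity) hhalf).trans ?_
    have := gauge_mul_div_le hg (c := 1 / 2) (by norm_num) (by norm_num) hy.le
    rw [show 1 / 2 * y = y / 2 by ring] at this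
    exact this.trans (by norm_num)
  have hk1 : h 1 ≤ h y / y := by simpa using hg.r1 hy hy1
  have h1pos := gauge_pos hg one_pos
  set k := h y / y
  set s := ‖q.eval (Complex.exp (pt (x, y) * Complex.I))‖ with hs
  have hk0 : 0 ≤ k := h1pos.le.trans hk1
  have hs' : s ≤ C * Real.exp (2 * ε * k) := hb.trans (by
    refine mul_le_mul_of_nonneg_left (Real.exp_le_exp.2 ?_) (zero_le_one.trans hC)
    linarith [mul_le_mul_of_nonneg_left hk2 hε])
  have hCe : 1 ≤ C * Real.exp (2 * ε * k) :=
    one_le_mul_of_one_le_of_one_le hC (Real.one_le_exp (by positivity))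
  have hsq : s ^ 2 + η ≤ (Real.exp 1 * (C * Real.exp (2 * ε * k))) ^ 2 := by
    have e1 : (2 : ℝ) ≤ Real.exp 1 ^ 2 := by nlinarith [Real.add_one_le_exp (1 : ℝ)]
    have e2 : s ^ 2 ≤ (C * Real.exp (2 * ε * k)) ^ 2 := pow_le_pow_left₀ (norm_nonneg _) hs' 2
    have e3 : 1 ≤ (C * Real.exp (2 * ε * k)) ^ 2 := one_le_pow₀ hCe
    rw [mul_pow]
    nlinarith
  have hnorm : ∀ c : ℂ, c.re ^ 2 + c.im ^ 2 = ‖c‖ ^ 2 := fun c => by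
    rw [← Complex.normSq_eq_norm_sq, Complex.normSq_apply]
    ring
  have hlog := Real.log_le_log (by positivity) hsq
  rw [Real.log_pow, Real.log_mul (Real.exp_ne_zero _) (by positivity), Real.log_exp,
    Real.log_mul (by positivity) (Real.exp_ne_zero _), Real.log_exp] at hlog
  have hlC : (0 : ℝ) ≤ 1 + Real.log C := by linarith [Real.log_nonneg hC]
  have hfrac : 1 + Real.log C ≤ (1 + Real.log C) / h 1 * k := by
    rw [div_mul_eq_mul_div, le_div_iff₀ h1pos]
    gcongr
  rw [regLog, hnorm]
  push_cast at hlog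
  linarith

/-- Jensen's inequality in the form of the tangent line bound for the logarithm. -/
theorem integral_regLog_mul_le {f : ℂ → ℂ} (hf : Continuous f) {W g V : ℝ → ℝ} {L t l η : ℝ}
    (ht : 0 < t) (hη : 0 < η) (hW0 : ∀ x, 0 ≤ W x)
    (hW : IntegrableOn W (Icc 0 L)) (hgm : Measurable g) (hg : ∀ x, g x ∈ Icc (0 : ℝ) 1)
    (hV : IntegrableOn V (Icc 0 L)) (hV0 : ∀ x, 0 ≤ V x)
    (hVW : ∀ᵐ x ∂volume.restrict (Icc 0 L), g x ≠ 0 → 0 < W x ∧ -Real.log (W x) ≤ V x) :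
    t * ∫ x in Icc 0 L, regLog f η x * g x ≤
      2 ^ (t / 2) / Real.exp l * ((∫ x in Icc 0 L, ‖f x‖ ^ t * W x) +
        η ^ (t / 2) * ∫ x in Icc 0 L, W x) + l * (∫ x in Icc 0 L, g x) +
        ∫ x in Icc 0 L, V x := by
  have hfx : Continuous fun x : ℝ => f x := hf.comp Complex.continuous_ofReal
  have ig : IntegrableOn g (Icc 0 L) :=
    (integrable_const (1 : ℝ)).mono' hgm.aestronglyMeasurable (ae_of_all _ fun x => by
      rw [Real.norm_eq_abs, abs_of_nonneg (hg x).1]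
      exact (hg x).2)
  have iu : IntegrableOn (fun x : ℝ => t * (regLog f η x * g x)) (Icc 0 L) :=
    (ig.continuousOn_mul ((continuous_regLog hf hη).comp
      Complex.continuous_ofReal).continuousOn isCompact_Icc).const_mul t
  have ifW : IntegrableOn (fun x : ℝ => ‖f x‖ ^ t * W x) (Icc 0 L) :=
    hW.continuousOn_mul ((hfx.norm.rpow_const fun x => Or.inr ht.le).continuousOn) isCompact_Icc
  have iηW : IntegrableOn (fun x : ℝ => η ^ (t / 2) * W x) (Icc 0 L) := hW.const_mul _
  have ilg : IntegrableOn (fun x : ℝ => l * g x) (Icc 0 L) := ig.const_mul _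
  have i1 : IntegrableOn (fun x : ℝ => 2 ^ (t / 2) / Real.exp l *
      (‖f x‖ ^ t * W x + η ^ (t / 2) * W x)) (Icc 0 L) := (ifW.add iηW).const_mul _
  have i2 : IntegrableOn (fun x : ℝ => 2 ^ (t / 2) / Real.exp l *
      (‖f x‖ ^ t * W x + η ^ (t / 2) * W x) + l * g x) (Icc 0 L) := i1.add ilg
  rw [← integral_const_mul, ← integral_const_mul, ← integral_add ifW iηW, ← integral_const_mul,
    ← integral_const_mul, ← integral_add i1 ilg, ← integral_add i2 hV]
  refine integral_mono_ae iu (i2.add hV) ?_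
  filter_upwards [hVW] with x hx
  have hWx := hW0 x
  by_cases hgx : g x = 0
  · simp only [hgx, mul_zero, add_zero]
    have := hV0 x
    positivity
  obtain ⟨hWp, hVx⟩ := hx hgx
  have hnorm : (f x).re ^ 2 + (f x).im ^ 2 = ‖f x‖ ^ 2 := by
    rw [← Complex.normSq_eq_norm_sq, Complex.normSq_apply]
    ring
  set s := ‖f x‖ with hs
  have hs0 : 0 ≤ s := norm_nonneg _
  set P := (s ^ 2 + η) ^ (t / 2) with hP
  have hPpos : 0 < P := by positivity
  have hlogP : Real.log P = t * regLog f η x := by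
    rw [hP, Real.log_rpow (by positivity), regLog, hnorm]
    ring
  have hPle : P ≤ 2 ^ (t / 2) * (s ^ t + η ^ (t / 2)) := by
    have e : (s ^ 2) ^ (t / 2) = s ^ t := by
      rw [← Real.rpow_natCast, ← Real.rpow_mul hs0]
      congr 1
      push_cast
      ring
    rcases le_total (s ^ 2) η with hle | hle
    · calc P ≤ (2 * η) ^ (t / 2) := Real.rpow_le_rpow (by positivity) (by linarith) (by positivity)
        _ = 2 ^ (t / 2) * η ^ (t / 2) := Real.mul_rpow zero_le_two hη.le
        _ ≤ _ := by
          gcongr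
          exact le_add_of_nonneg_left (by positivity)
    · calc P ≤ (2 * s ^ 2) ^ (t / 2) :=
            Real.rpow_le_rpow (by positivity) (by linarith) (by positivity)
        _ = 2 ^ (t / 2) * s ^ t := by rw [Real.mul_rpow zero_le_two (by positivity), e]
        _ ≤ _ := by
          gcongr
          exact le_add_of_nonneg_right (by positivity)
  have hlog : t * regLog f η x ≤ P * W x / Real.exp l + l + V x := by
    have e1 := Real.log_le_sub_one_of_pos (show 0 < P * W x / Real.exp l by positivity)
    rw [Real.log_div (by positivity) (Real.exp_ne_zero _), Real.log_mul hPpos.ne' hWp.ne',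
      Real.log_exp, hlogP] at e1
    linarith
  have hbound : P * W x / Real.exp l ≤ 2 ^ (t / 2) / Real.exp l *
      (s ^ t * W x + η ^ (t / 2) * W x) := by
    calc P * W x / Real.exp l ≤ 2 ^ (t / 2) * (s ^ t + η ^ (t / 2)) * W x / Real.exp l := by gcongr
      _ = _ := by ring
  have g0 := (hg x).1
  have g1 := (hg x).2
  have a1 := mul_le_mul_of_nonneg_right hlog g0
  have a2 : P * W x / Real.exp l * g x ≤ P * W x / Real.exp l :=
    mul_le_of_le_one_right (by positivity) g1
  have a3 : V x * g x ≤ V x := mul_le_of_le_one_right (hV0 x) g1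
  show t * (regLog f η x * g x) ≤ 2 ^ (t / 2) / Real.exp l *
      (s ^ t * W x + η ^ (t / 2) * W x) + l * g x + V x
  linarith

end SplittingSharpness

namespace SplittingSharpness

variable {E : Set UnitCircle} {h : ℝ → ℝ}

theorem measurable_nlog : Measurable nlog :=
  Measurable.ite (measurableSet_singleton 0) measurable_const
    (Real.measurable_log.comp measurable_inv).ennreal_ofReal

theorem neg_log_le_toReal_nlog {s : ℝ} (hs : s ≠ 0) : -Real.log s ≤ (nlog s).toReal := by
  rw [nlog, if_neg hs, ENNReal.toReal_ofReal', Real.log_inv]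
  exact le_max_left _ _

theorem circleEmbed_coe (x : ℝ) : circleEmbed x = Complex.exp (x * Complex.I) := by
  rw [circleEmbed, AddCircle.toCircle_apply_mk, div_self (by positivity), one_mul,
    Circle.coe_exp]

theorem measurePreserving_coe : MeasurePreserving (fun x : ℝ => (x : UnitCircle))
    (volume.restrict (Icc 0 (2 * Real.pi))) volume := by
  have := AddCircle.measurePreserving_mk (2 * Real.pi) 0
  rwa [zero_add, Measure.restrict_congr_set Ioc_ae_eq_Icc] at this

/-- The weighted moments of a polynomial on the circle, unfolded to an interval. -/
theorem integral_norm_rpow_mul {w : UnitCircle → ℝ} (hw0 : ∀ ζ, 0 ≤ w ζ)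
    (hw1 : Integrable w volume) {t : ℝ} (ht : 0 < t) (q : Polynomial ℂ) :
    ∫ x in Icc 0 (2 * Real.pi), ‖q.eval (Complex.exp ((x : ℂ) * Complex.I))‖ ^ t * w x =
      (∫⁻ ζ, (‖q.eval (circleEmbed ζ)‖₊ : ENNReal) ^ t * ENNReal.ofReal (w ζ)).toReal := by
  have hW : Integrable (fun x : ℝ => w x) (volume.restrict (Icc 0 (2 * Real.pi))) :=
    (measurePreserving_coe.integrable_comp hw1.aestronglyMeasurable).2 hw1
  have hc : Continuous fun x : ℝ => ‖q.eval (Complex.exp ((x : ℂ) * Complex.I))‖ ^ t :=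
    Continuous.rpow_const (by fun_prop) fun x => Or.inr ht.le
  have h0 : ∀ x : ℝ, 0 ≤ ‖q.eval (Complex.exp ((x : ℂ) * Complex.I))‖ ^ t * w x := fun x =>
    mul_nonneg (by positivity) (hw0 x)
  rw [integral_eq_lintegral_of_nonneg_ae (ae_of_all _ h0)
    (hc.aestronglyMeasurable.mul hW.aestronglyMeasurable),
    ← AddCircle.lintegral_preimage (2 * Real.pi) 0, zero_add,
    Measure.restrict_congr_set Ioc_ae_eq_Icc]
  congr 1
  refine lintegral_congr fun x => ?_
  rw [ENNReal.ofReal_mul (by positivity), circleEmbed_coe,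
    ← ENNReal.ofReal_rpow_of_nonneg (norm_nonneg _) ht.le, ofReal_norm]
  rfl

/-- Polynomials with a one-sided bound by the gauge and vanishing weighted moments tend to zero at
the origin. -/
theorem tendsto_eval_zero (hg : IsGauge h) (hhm : Continuous h) {D : ℝ} (hD0 : 0 ≤ D)
    (hD : ∀ ℓ, 0 < ℓ → ℓ ≤ 2 * Real.pi →
      ∫⁻ x in Ioc 0 ℓ, ENNReal.ofReal (h x / x) ≤ ENNReal.ofReal (D * h ℓ))
    (hE : IsHCarleson h E) (hpos : 0 < volume E)
    {w : UnitCircle → ℝ} (hw0 : ∀ ζ, 0 ≤ w ζ) (hw1 : Integrable w volume)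
    (hEw : ∫⁻ ζ in E, nlog (w ζ) ≠ ⊤) {t ε C : ℝ} (ht : 0 < t) (hε : 0 ≤ ε) (hC : 1 ≤ C)
    {p : ℕ → Polynomial ℂ}
    (hi : Tendsto (fun N => ∫⁻ ζ, (‖(p N).eval (circleEmbed ζ)‖₊ : ENNReal) ^ t *
        ENNReal.ofReal (w ζ)) atTop (𝓝 0))
    (hp : ∀ N, ∀ z : ℂ, 1 / 3 ≤ ‖z‖ → ‖z‖ < 1 →
      ‖(p N).eval z‖ ≤ C * Real.exp (ε * (h (1 - ‖z‖) / (1 - ‖z‖)))) :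
    Tendsto (fun N => (p N).eval 0) atTop (𝓝 0) := by
  obtain ⟨g, hgm, hg01, hgE, hgpos, A, hA⟩ := exists_regLog_bound hg hhm hD0 hD hE hpos
  set G := ∫ x in Icc 0 (2 * Real.pi), g x with hG
  have hW : IntegrableOn (fun x : ℝ => w x) (Icc 0 (2 * Real.pi)) :=
    (measurePreserving_coe.integrable_comp hw1.aestronglyMeasurable).2 hw1
  set n : UnitCircle → ENNReal := E.indicator fun ζ => nlog (w ζ) with hn
  have hnm : AEMeasurable n volume :=
    (measurable_nlog.comp_aemeasurable hw1.aemeasurable).indicator hE.1.measurableSet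
  have hnI : ∫⁻ ζ, n ζ ≠ ⊤ := by rwa [hn, lintegral_indicator hE.1.measurableSet]
  have hVi := integrable_toReal_of_lintegral_ne_top hnm hnI
  have hV : IntegrableOn (fun x : ℝ => (n x).toReal) (Icc 0 (2 * Real.pi)) :=
    (measurePreserving_coe.integrable_comp hVi.aestronglyMeasurable).2 hVi
  have hVW : ∀ᵐ x : ℝ ∂volume.restrict (Icc 0 (2 * Real.pi)),
      g x ≠ 0 → 0 < w x ∧ -Real.log (w x) ≤ (n x).toReal := by
    filter_upwards [measurePreserving_coe.quasiMeasurePreserving.ae (ae_lt_top' hnm hnI)]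
      with x hx hgx
    have hxE : (x : UnitCircle) ∈ E := by
      by_contra hxE
      exact hgx (hgE x hxE)
    rw [hn, indicator_of_mem hxE] at hx ⊢
    have hw : w x ≠ 0 := fun h0 => by simp [h0, nlog] at hx
    exact ⟨(hw0 x).lt_of_ne' hw, neg_log_le_toReal_nlog hw⟩
  set B := ∫ x in Icc 0 (2 * Real.pi), (n (x : UnitCircle)).toReal with hB
  set w₁ := ∫ x in Icc 0 (2 * Real.pi), w (x : UnitCircle) with hw₁
  set C₁ := (1 + Real.log C) / h 1 + 2 * ε with hC₁
  have hC₁0 : 0 ≤ C₁ := by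
    have := Real.log_nonneg hC
    have := gauge_pos hg one_pos
    positivity
  set a : ℕ → ℝ := fun N => (∫⁻ ζ, (‖(p N).eval (circleEmbed ζ)‖₊ : ENNReal) ^ t *
        ENNReal.ofReal (w ζ)).toReal with ha
  have key : ∀ N (l η : ℝ), 0 < η → η ≤ 1 → (p N).eval 0 ≠ 0 →
      60 * Real.pi * t * Real.log ‖(p N).eval 0‖ ≤ t * (C₁ * A) +
        (2 ^ (t / 2) / Real.exp l * (a N + η ^ (t / 2) * w₁) + l * G + B) := by
    intro N l η hη hη1 hN
    have hfd : Differentiable ℂ fun ζ => (p N).eval (Complex.exp (ζ * Complex.I)) := by fun_prop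
    have hper : Function.Periodic (fun ζ => (p N).eval (Complex.exp (ζ * Complex.I)))
        ((2 * Real.pi : ℝ) : ℂ) := fun ζ => by
      push_cast
      rw [add_mul, Complex.exp_add, Complex.exp_two_pi_mul_I, mul_one]
    have h1 := hA C₁ (Real.log ‖(p N).eval 0‖) η _ hC₁0 hη hfd hper
      (fun x y hy hy1 => regLog_le_gauge hg hC hε (hp N) hη hη1 x hy hy1)
      (fun y _ _ => log_eval_zero_le_integral_regLog hN hη y)
    have h2 := integral_regLog_mul_le (l := l) hfd.continuous ht hη (fun x => hw0 x) hW hgm hg01 hV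
      (fun x => ENNReal.toReal_nonneg) hVW
    rw [integral_norm_rpow_mul hw0 hw1 ht] at h2
    have h3 := mul_le_mul_of_nonneg_left h1 ht.le
    simp only [ha]
    linarith
  have ha0 : Tendsto a atTop (𝓝 0) := by
    have := (ENNReal.tendsto_toReal ENNReal.zero_ne_top).comp hi
    rwa [ENNReal.toReal_zero] at this
  have hη0 : Tendsto (fun N : ℕ => (1 / ((N : ℝ) + 1)) ^ (t / 2)) atTop (𝓝 0) := by
    have h1 := (tendsto_one_div_add_atTop_nhds_zero_nat (𝕜 := ℝ)).rpow_const
      (p := t / 2) (Or.inr (by positivity))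
    rwa [Real.zero_rpow (by positivity)] at h1
  rw [Metric.tendsto_atTop']
  intro r hr
  set l := (60 * Real.pi * t * Real.log (r / 2) - t * (C₁ * A) - 1 - B) / G with hl
  have hlG : l * G = 60 * Real.pi * t * Real.log (r / 2) - t * (C₁ * A) - 1 - B :=
    div_mul_cancel₀ _ hgpos.ne'
  have hS : Tendsto (fun N => 2 ^ (t / 2) / Real.exp l *
      (a N + (1 / ((N : ℝ) + 1)) ^ (t / 2) * w₁)) atTop (𝓝 0) := by
    simpa using (ha0.add (hη0.mul_const w₁)).const_mul (2 ^ (t / 2) / Real.exp l)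
  obtain ⟨N₀, hN₀⟩ := eventually_atTop.1 (hS.eventually (eventually_le_nhds (zero_lt_one (α := ℝ))))
  refine ⟨N₀, fun N hN => ?_⟩
  rw [dist_zero_right]
  by_cases hz : (p N).eval 0 = 0
  · rwa [hz, norm_zero]
  have h1 := key N l (1 / (N + 1)) (by positivity) (by
    rw [div_le_one (by positivity)]
    linarith [N.cast_nonneg (α := ℝ)]) hz
  have h2 := hN₀ N hN.le
  have h3 : 60 * Real.pi * t * Real.log ‖(p N).eval 0‖ ≤ 60 * Real.pi * t * Real.log (r / 2) := by
    linarith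
  have h4 := (Real.log_le_log_iff (norm_pos_iff.2 hz) (by positivity)).1
    (le_of_mul_le_mul_left h3 (by positivity))
  linarith

end SplittingSharpness

namespace SplittingSharpness

variable {E : Set UnitCircle} {h : ℝ → ℝ}

theorem norm_mul_eval_divX_le (q : Polynomial ℂ) (z : ℂ) :
    ‖z‖ * ‖q.divX.eval z‖ ≤ ‖q.eval z‖ + ‖q.eval 0‖ := by
  have h1 := congrArg (Polynomial.eval z) (Polynomial.divX_mul_X_add q)
  simp only [Polynomial.eval_add, Polynomial.eval_mul, Polynomial.eval_X, Polynomial.eval_C,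
    Polynomial.coeff_zero_eq_eval_zero] at h1
  rw [← norm_mul, mul_comm, eq_sub_of_add_eq h1]
  exact norm_sub_le _ _

theorem norm_circleEmbed (ζ : UnitCircle) : ‖circleEmbed ζ‖ = 1 := Circle.norm_coe _

theorem ennreal_add_rpow_le {t : ℝ} (ht : 0 < t) (a b : ENNReal) :
    (a + b) ^ t ≤ 2 ^ t * (a ^ t + b ^ t) := by
  have h1 : a + b ≤ 2 * max a b := by
    rw [two_mul]
    exact add_le_add (le_max_left _ _) (le_max_right _ _)
  refine (ENNReal.rpow_le_rpow h1 ht.le).trans ?_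
  rw [ENNReal.mul_rpow_of_nonneg _ _ ht.le]
  gcongr
  rcases max_choice a b with h2 | h2 <;> rw [h2]
  exacts [le_self_add, le_add_self]

theorem lintegral_divX_le {w : UnitCircle → ℝ} (hw1 : Integrable w volume) {t : ℝ} (ht : 0 < t)
    (q : Polynomial ℂ) :
    ∫⁻ ζ, (‖q.divX.eval (circleEmbed ζ)‖₊ : ENNReal) ^ t * ENNReal.ofReal (w ζ) ≤
      2 ^ t * ((∫⁻ ζ, (‖q.eval (circleEmbed ζ)‖₊ : ENNReal) ^ t * ENNReal.ofReal (w ζ)) +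
        (‖q.eval 0‖₊ : ENNReal) ^ t * ∫⁻ ζ, ENNReal.ofReal (w ζ)) := by
  have hwm := hw1.aestronglyMeasurable.aemeasurable.ennreal_ofReal
  rw [← lintegral_const_mul'' _ hwm, ← lintegral_add_right' _ (hwm.const_mul _),
    ← lintegral_const_mul' _ _ (by finiteness)]
  refine lintegral_mono fun ζ => ?_
  rw [← add_mul, ← mul_assoc]
  gcongr
  refine le_trans ?_ (ennreal_add_rpow_le ht _ _)
  refine ENNReal.rpow_le_rpow ?_ ht.le
  have := norm_mul_eval_divX_le q (circleEmbed ζ)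
  rw [norm_circleEmbed, one_mul] at this
  exact_mod_cast this

theorem tendsto_lintegral_divX {w : UnitCircle → ℝ} (hw1 : Integrable w volume) {t : ℝ}
    (ht : 0 < t) {p : ℕ → Polynomial ℂ}
    (hi : Tendsto (fun N => ∫⁻ ζ, (‖(p N).eval (circleEmbed ζ)‖₊ : ENNReal) ^ t *
        ENNReal.ofReal (w ζ)) atTop (𝓝 0))
    (h0 : Tendsto (fun N => (p N).eval 0) atTop (𝓝 0)) :
    Tendsto (fun N => ∫⁻ ζ, (‖(p N).divX.eval (circleEmbed ζ)‖₊ : ENNReal) ^ t *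
        ENNReal.ofReal (w ζ)) atTop (𝓝 0) := by
  refine tendsto_of_tendsto_of_tendsto_of_le_of_le tendsto_const_nhds ?_ (fun _ => zero_le)
    fun N => lintegral_divX_le hw1 ht (p N)
  have h1 : Tendsto (fun N => (‖(p N).eval 0‖₊ : ENNReal) ^ t) atTop (𝓝 0) := by
    have h2 : Tendsto (fun N => (‖(p N).eval 0‖₊ : ENNReal)) atTop (𝓝 0) := by
      have := h0.enorm
      rwa [enorm_zero] at this
    have := h2.ennrpow_const t
    rwa [ENNReal.zero_rpow_of_pos ht] at this
  have hW : ∫⁻ ζ, ENNReal.ofReal (w ζ) ≠ ⊤ := hw1.lintegral_lt_top.ne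
  have h3 := ENNReal.Tendsto.mul_const h1 (Or.inr hW)
  have h4 := ENNReal.Tendsto.const_mul (a := 2 ^ t) (hi.add h3) (Or.inr (by finiteness))
  simpa using h4

theorem norm_eval_divX_le {p : ℕ → Polynomial ℂ} {ψ : ℝ → ℝ} {C : ℝ} (hC : 1 ≤ C)
    (hψ : ∀ r, r < 1 → 1 ≤ ψ r)
    (hp : ∀ N, ∀ z : ℂ, 1 / 3 ≤ ‖z‖ → ‖z‖ < 1 → ‖(p N).eval z‖ ≤ C * ψ ‖z‖)
    (h0 : Tendsto (fun N => (p N).eval 0) atTop (𝓝 0)) :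
    ∃ C' : ℝ, 1 ≤ C' ∧ ∀ N, ∀ z : ℂ, 1 / 3 ≤ ‖z‖ → ‖z‖ < 1 →
      ‖(p N).divX.eval z‖ ≤ C' * ψ ‖z‖ := by
  obtain ⟨M, hM⟩ := (Metric.isBounded_range_of_tendsto _ h0).exists_norm_le
  have hM' : ∀ N, ‖(p N).eval 0‖ ≤ M := fun N => hM _ (mem_range_self N)
  have hM0 : 0 ≤ M := (norm_nonneg _).trans (hM' 0)
  refine ⟨3 * (C + M), by linarith, fun N z hz hz1 => ?_⟩
  have h1 := norm_mul_eval_divX_le (p N) z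
  have h2 := hp N z hz hz1
  have h3 : M ≤ M * ψ ‖z‖ := le_mul_of_one_le_right hM0 (hψ _ hz1)
  have h4 := mul_le_mul_of_nonneg_right hz (norm_nonneg ((p N).divX.eval z))
  linarith [hM' N]

theorem tendsto_coeff (hg : IsGauge h) (hhm : Continuous h) {D : ℝ} (hD0 : 0 ≤ D)
    (hD : ∀ ℓ, 0 < ℓ → ℓ ≤ 2 * Real.pi →
      ∫⁻ x in Ioc 0 ℓ, ENNReal.ofReal (h x / x) ≤ ENNReal.ofReal (D * h ℓ))
    (hE : IsHCarleson h E) (hpos : 0 < volume E)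
    {w : UnitCircle → ℝ} (hw0 : ∀ ζ, 0 ≤ w ζ) (hw1 : Integrable w volume)
    (hEw : ∫⁻ ζ in E, nlog (w ζ) ≠ ⊤) {t ε : ℝ} (ht : 0 < t) (hε : 0 ≤ ε) (k : ℕ) :
    ∀ {C : ℝ} {p : ℕ → Polynomial ℂ}, 1 ≤ C →
    Tendsto (fun N => ∫⁻ ζ, (‖(p N).eval (circleEmbed ζ)‖₊ : ENNReal) ^ t *
        ENNReal.ofReal (w ζ)) atTop (𝓝 0) →
    (∀ N, ∀ z : ℂ, 1 / 3 ≤ ‖z‖ → ‖z‖ < 1 →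
      ‖(p N).eval z‖ ≤ C * Real.exp (ε * (h (1 - ‖z‖) / (1 - ‖z‖)))) →
    Tendsto (fun N => (p N).coeff k) atTop (𝓝 0) := by
  induction k with
  | zero =>
    intro C p hC hi hp
    simpa only [Polynomial.coeff_zero_eq_eval_zero] using
      tendsto_eval_zero hg hhm hD0 hD hE hpos hw0 hw1 hEw ht hε hC hi hp
  | succ k ih =>
    intro C p hC hi hp
    have h0 := tendsto_eval_zero hg hhm hD0 hD hE hpos hw0 hw1 hEw ht hε hC hi hp
    obtain ⟨C', hC', hp'⟩ := norm_eval_divX_le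
      (ψ := fun r => Real.exp (ε * (h (1 - r) / (1 - r)))) hC (fun r hr => by
        have h1 : 0 < 1 - r := by linarith
        have h2 := gauge_nonneg hg h1.le
        exact Real.one_le_exp (by positivity)) hp h0
    simpa only [Polynomial.coeff_divX] using ih hC' (tendsto_lintegral_divX hw1 ht hi h0) hp'

theorem iteratedDeriv_eval (q : Polynomial ℂ) (k : ℕ) :
    iteratedDeriv k (fun z => q.eval z) = fun z => (Polynomial.derivative^[k] q).eval z := by
  induction k with
  | zero => simp
  | succ k ih =>
    rw [iteratedDeriv_succ, ih, Function.iterate_succ_apply']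
    ext z
    exact Polynomial.deriv _

theorem norm_coeff_le {q : Polynomial ℂ} {ρ M : ℝ} (hρ : 0 < ρ)
    (hq : ∀ z : ℂ, ‖z‖ = ρ → ‖q.eval z‖ ≤ M) (k : ℕ) : ‖q.coeff k‖ ≤ M / ρ ^ k := by
  have h1 := Complex.norm_iteratedDeriv_le_of_forall_mem_sphere_norm_le (c := 0) k hρ
    (f := fun z => q.eval z) q.differentiable.diffContOnCl
    (fun z hz => hq z (mem_sphere_zero_iff_norm.1 hz))
  have h2 : (Polynomial.derivative^[k] q).eval 0 = k.factorial * q.coeff k := by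
    rw [← Polynomial.coeff_zero_eq_eval_zero, Polynomial.coeff_iterate_derivative, zero_add,
      Nat.descFactorial_self, nsmul_eq_mul]
  simp only [iteratedDeriv_eval] at h1
  rw [h2, norm_mul, Complex.norm_natCast, mul_div_assoc] at h1
  exact le_of_mul_le_mul_left h1 (by positivity)

theorem norm_eval_le_tsum (q : Polynomial ℂ) {r : ℝ} {z : ℂ} (hz : ‖z‖ ≤ r) :
    ‖q.eval z‖ ≤ ∑' k, ‖q.coeff k‖ * r ^ k := by
  have hr : 0 ≤ r := (norm_nonneg z).trans hz
  have hs : Summable fun k => ‖q.coeff k‖ * r ^ k :=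
    summable_of_ne_finset_zero (s := Finset.range (q.natDegree + 1)) fun k hk => by
      rw [Polynomial.coeff_eq_zero_of_natDegree_lt (by simpa using hk), norm_zero, zero_mul]
  rw [Polynomial.eval_eq_sum_range]
  refine (norm_sum_le _ _).trans (le_trans (Finset.sum_le_sum fun k _ => ?_)
    (hs.sum_le_tsum (Finset.range (q.natDegree + 1)) fun k _ => by positivity))
  rw [norm_mul, norm_pow]
  gcongr

theorem tendstoUniformlyOn_of_tendsto_coeff {p : ℕ → Polynomial ℂ} {r ρ M : ℝ} (hr : 0 ≤ r)
    (hρ : r < ρ) (hM : ∀ N, ∀ z : ℂ, ‖z‖ = ρ → ‖(p N).eval z‖ ≤ M)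
    (hc : ∀ k, Tendsto (fun N => (p N).coeff k) atTop (𝓝 0)) :
    TendstoUniformlyOn (fun N z => (p N).eval z) (fun _ => 0) atTop (Metric.closedBall 0 r) := by
  have hρ0 : 0 < ρ := hr.trans_lt hρ
  have h1 : Tendsto (fun N => ∑' k, ‖(p N).coeff k‖ * r ^ k) atTop (𝓝 (∑' _ : ℕ, (0 : ℝ))) := by
    refine tendsto_tsum_of_dominated_convergence (bound := fun k => M * (r / ρ) ^ k)
      ((summable_geometric_of_lt_one (by positivity) ((div_lt_one hρ0).2 hρ)).mul_left M)
      (fun k => by simpa using (hc k).norm.mul_const (r ^ k))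
      (Eventually.of_forall fun N k => ?_)
    rw [norm_mul, norm_norm, norm_pow, Real.norm_of_nonneg hr, div_pow, ← mul_div_assoc,
      mul_div_right_comm]
    exact mul_le_mul_of_nonneg_right (norm_coeff_le hρ0 (hM N) k) (by positivity)
  rw [tsum_zero] at h1
  rw [Metric.tendstoUniformlyOn_iff]
  intro δ hδ
  filter_upwards [h1.eventually_lt_const hδ] with N hN z hz
  rw [dist_zero_left]
  exact (norm_eval_le_tsum _ (mem_closedBall_zero_iff.1 hz)).trans_lt hN

theorem isGauge_comp_max (hg : IsGauge h) : IsGauge fun x => h (max 0 x) where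
  continuousOn := hg.continuousOn.comp (by fun_prop) fun x _ => mem_Ici.2 (le_max_left 0 x)
  mono := fun x _ y _ hxy => hg.mono (mem_Ici.2 (le_max_left 0 x)) (mem_Ici.2 (le_max_left 0 y))
    (max_le_max le_rfl hxy)
  zero := by simpa using hg.zero
  r1 := fun x y hx hxy => by
    simpa only [max_eq_right hx.le, max_eq_right (hx.le.trans hxy)] using hg.r1 hx hxy
  r2 := hg.r2.congr' (by
    filter_upwards [self_mem_nhdsWithin] with x hx
    rw [max_eq_right (le_of_lt hx)])

theorem exists_norm_le_of_isCompact {K : Set ℂ} (hK : K ⊆ Metric.ball 0 1) (hKc : IsCompact K) :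
    ∃ r : ℝ, 0 ≤ r ∧ r < 1 ∧ K ⊆ Metric.closedBall 0 r := by
  rcases K.eq_empty_or_nonempty with rfl | hne
  · exact ⟨0, le_rfl, one_pos, empty_subset _⟩
  obtain ⟨z, hz, hmax⟩ := hKc.exists_isMaxOn hne continuous_norm.continuousOn
  exact ⟨‖z‖, norm_nonneg z, mem_ball_zero_iff.1 (hK hz),
    fun x hx => mem_closedBall_zero_iff.2 (hmax hx)⟩

end SplittingSharpness

/-- sharpness. Suppose `h` moreover satisfies the Dini-type
condition (R3): `∫_0^ℓ h(x)/x dx ≤ C h(ℓ)` for small `ℓ`. If a sequence of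
polynomials satisfies (i') `∫_𝕋 |p_N|^t w |dz| → 0` and (ii') the uniform bound
`|p_N(z)| ≤ exp(ε h(1-|z|)/(1-|z|))` on `𝔻`, and if `∫_E log w |dz| > -∞` for some
`h`-Carleson set `E` of positive measure, then `p_N → 0` uniformly on compact
subsets of `𝔻`. -/
theorem splitting_sharpness (h : ℝ → ℝ) (hg : IsGauge h)
    (C ℓ₀ : ℝ) (hC : 1 ≤ C) (hℓ₀ : 0 < ℓ₀)
    (hR3 : ∀ ℓ : ℝ, 0 < ℓ → ℓ ≤ ℓ₀ →
      IntervalIntegrable (fun x => h x / x) volume 0 ℓ ∧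
      (∫ x in (0:ℝ)..ℓ, h x / x) ≤ C * h ℓ)
    (w : UnitCircle → ℝ) (hw0 : ∀ ζ, 0 ≤ w ζ) (hw1 : Integrable w volume)
    (t ε : ℝ) (ht : 0 < t) (hε : 0 < ε)
    (p : ℕ → Polynomial ℂ)
    (hi : Tendsto (fun N => ∫⁻ ζ, (‖(p N).eval (circleEmbed ζ)‖₊ : ENNReal) ^ t *
        ENNReal.ofReal (w ζ)) atTop (𝓝 0))
    (hii : ∀ N : ℕ, ∀ z ∈ Metric.ball (0 : ℂ) 1,
      ‖(p N).eval z‖ ≤ Real.exp (ε * h (1 - ‖z‖) / (1 - ‖z‖)))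
    (E : Set UnitCircle) (hE : IsHCarleson h E) (hEpos : 0 < volume E)
    (hEconv : ∫⁻ ζ in E, nlog (w ζ) ≠ ⊤) :
    ∀ K : Set ℂ, K ⊆ Metric.ball 0 1 → IsCompact K →
      TendstoUniformlyOn (fun N z => (p N).eval z) (fun _ => 0) atTop K := by
  intro K hK hKc
  obtain ⟨r, hr0, hr1, hKr⟩ := SplittingSharpness.exists_norm_le_of_isCompact hK hKc
  refine TendstoUniformlyOn.mono ?_ hKr
  obtain ⟨D, hD0, hD⟩ := SplittingSharpness.gauge_dini hg hC hℓ₀ hR3 (2 * Real.pi)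
  have hE' : IsHCarleson (fun x => h (max 0 x)) E := by
    simpa only [IsHCarleson, max_eq_right ENNReal.toReal_nonneg] using hE
  have hcont : Continuous fun x => h (max 0 x) :=
    hg.continuousOn.comp_continuous (by fun_prop) fun x => mem_Ici.2 (le_max_left 0 x)
  refine SplittingSharpness.tendstoUniformlyOn_of_tendsto_coeff (ρ := (1 + r) / 2)
    (M := Real.exp (ε * h (1 - (1 + r) / 2) / (1 - (1 + r) / 2))) hr0 (by linarith)
    (fun N z hz => ?_) fun k => ?_
  · rw [← hz]
    exact hii N z (mem_ball_zero_iff.2 (by linarith))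
  · refine SplittingSharpness.tendsto_coeff (SplittingSharpness.isGauge_comp_max hg) hcont hD0
      (fun ℓ hℓ hℓ' => ?_) hE' hEpos hw0 hw1 hEconv ht hε.le k le_rfl hi fun N z _ hz => ?_
    · rw [max_eq_right hℓ.le]
      refine le_trans (le_of_eq (setLIntegral_congr_fun measurableSet_Ioc fun x hx => ?_))
        (hD ℓ hℓ hℓ')
      simp only [max_eq_right hx.1.le]
    · rw [max_eq_right (by linarith), one_mul, ← mul_div_assoc]
      exact hii N z (mem_ball_zero_iff.2 hz)
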